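/- arXiv:1612.02518 — 5 statements merged into one kernel-verified Lean document; each statement's English description precedes it below -/
import Mathlib

section
/- For every k ∈ ℂ, the quotient ring ℂ[x,y,z]/(x² + y² + z² − xyz − 2 − k) is an integrally closed integral domain (i.e., a normal domain). -/
open MvPolynomial

/-- In a UFD, a squarefree `Δ` with `d² ∣ β² Δ` forces `d ∣ β`. -/
theorem dvd_of_sq_dvd_sq_mul_squarefree {R : Type*} [CommRing R] [IsDomain R]
    [UniqueFactorizationMonoid R] {Δ d β : R} (hΔ : Squarefree Δ) (hd : d ≠ 0)
    (h : d ^ 2 ∣ β ^ 2 * Δ) : d ∣ β := by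
  obtain ⟨d', β', c, hrel, rfl, rfl⟩ := UniqueFactorizationMonoid.exists_reduced_factors d hd β
  have hc : c ≠ 0 := left_ne_zero_of_mul hd
  have h2 : d' ^ 2 ∣ β' ^ 2 * Δ := by
    have : c ^ 2 * d' ^ 2 ∣ c ^ 2 * (β' ^ 2 * Δ) := by
      convert h using 1 <;> ring
    exact (mul_dvd_mul_iff_left (pow_ne_zero 2 hc)).1 this
  have h3 : d' ^ 2 ∣ Δ := (hrel.pow).dvd_of_dvd_mul_left h2
  have h4 : IsUnit d' := hΔ d' (by rwa [← sq])
  exact mul_dvd_mul_left c h4.dvd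

/-- A fraction of elements of an integrally closed domain, integral in an extension field. -/
theorem dvd_of_isIntegral_div {R L : Type*} [CommRing R] [IsDomain R] [IsIntegrallyClosed R]
    [Field L] [Algebra R L] (hinj : Function.Injective (algebraMap R L)) {p d : R} (hd : d ≠ 0)
    (h : IsIntegral R (algebraMap R L p / algebraMap R L d)) : d ∣ p := by
  let φ : FractionRing R →ₐ[R] L :=
    IsFractionRing.liftAlgHom (g := Algebra.ofId R L) hinj
  have hφ : φ (algebraMap R _ p / algebraMap R _ d) = algebraMap R L p / algebraMap R L d := by
    rw [map_div₀, φ.commutes, φ.commutes]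
  rw [← hφ, isIntegral_algHom_iff φ φ.toRingHom.injective, IsIntegrallyClosed.isIntegral_iff] at h
  obtain ⟨y, hy⟩ := h
  have hd' : algebraMap R (FractionRing R) d ≠ 0 := by
    simpa using hd
  rw [eq_div_iff hd', ← map_mul] at hy
  exact ⟨y, by rw [mul_comm]; exact (IsFractionRing.injective R (FractionRing R) hy).symm⟩

/-- Normality of a quadratic extension with squarefree discriminant. -/
theorem normal_of_quadratic {R S : Type*} (L : Type*) [CommRing R] [IsDomain R]
    [UniqueFactorizationMonoid R] [CommRing S] [IsDomain S] [Algebra R S] [Algebra.IsIntegral R S]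
    [Field L] [Algebra S L] [IsFractionRing S L] [Algebra R L] [IsScalarTower R S L]
    (hinj : Function.Injective (algebraMap R S)) (h2 : IsUnit (2 : R)) (b c : R) (τ : S)
    (hτ : τ ^ 2 = algebraMap R S b * τ - algebraMap R S c)
    (hS : ∀ s : S, ∃ p q : R, s = algebraMap R S p + algebraMap R S q * τ)
    (σ : S →ₐ[R] S) (hσ : σ τ = algebraMap R S b - τ)
    (hΔ : Squarefree (b ^ 2 - 4 * c)) : IsIntegrallyClosed S := by
  have hσσ : ∀ s, σ (σ s) = s := by
    intro s
    obtain ⟨p, q, rfl⟩ := hS s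
    simp [hσ]
  have hσinj : Function.Injective σ := Function.LeftInverse.injective hσσ
  have hnorm : ∀ s : S, ∃ n : R, s * σ s = algebraMap R S n := by
    intro s
    obtain ⟨p, q, rfl⟩ := hS s
    refine ⟨p ^ 2 + p * q * b + c * q ^ 2, ?_⟩
    simp only [map_add, map_mul, map_pow, AlgHom.commutes, hσ]
    linear_combination (-(algebraMap R S q) ^ 2) * hτ
  rw [isIntegrallyClosed_iff L]
  intro x hx
  have hxR : IsIntegral R x := isIntegral_trans x hx
  have hinjL : Function.Injective (algebraMap R L) := by
    rw [IsScalarTower.algebraMap_eq R S L]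
    exact (IsFractionRing.injective S L).comp hinj
  let g : S →ₐ[R] L := (IsScalarTower.toAlgHom R S L).comp σ
  have hg : Function.Injective g := (IsFractionRing.injective S L).comp hσinj
  let conj : L →ₐ[R] L := IsFractionRing.liftAlgHom (g := g) hg
  have hconj : ∀ s : S, conj (algebraMap S L s) = algebraMap S L (σ s) := fun s =>
    IsFractionRing.lift_algebraMap hg s
  obtain ⟨s1, s2, hs2, rfl⟩ := IsFractionRing.div_surjective (A := S) x
  have hs2' : s2 ≠ 0 := nonZeroDivisors.ne_zero hs2
  obtain ⟨d, hd⟩ := hnorm s2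
  have hσs2 : σ s2 ≠ 0 := fun h => hs2' (hσinj (by rw [h, map_zero]))
  have hd0 : d ≠ 0 := by
    rintro rfl
    rw [map_zero] at hd
    exact mul_ne_zero hs2' hσs2 hd
  obtain ⟨p, q, hpq⟩ := hS (s1 * σ s2)
  have hdL : algebraMap R L d ≠ 0 := fun h => hd0 (hinjL (by rw [h, map_zero]))
  have hRS : ∀ r : R, algebraMap S L (algebraMap R S r) = algebraMap R L r := fun r =>
    (IsScalarTower.algebraMap_apply R S L r).symm
  set t : L := algebraMap S L τ with ht
  have hxeq : algebraMap S L s1 / algebraMap S L s2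
      = (algebraMap R L p + algebraMap R L q * t) / algebraMap R L d := by
    have e1 : algebraMap S L s2 ≠ 0 := by simpa using hs2'
    rw [div_eq_div_iff e1 hdL, ← hRS d, ← hRS p, ← hRS q, ht, ← map_mul, ← map_mul, ← map_add,
      ← map_mul, ← hd, ← hpq]
    congr 1; ring
  rw [hxeq] at hxR ⊢
  have hyR := hxR.map conj
  have htL : t ^ 2 = algebraMap R L b * t - algebraMap R L c := by
    rw [ht, ← map_pow, hτ, map_sub, map_mul, hRS, hRS]
  have hconjt : conj t = algebraMap R L b - t := by
    rw [ht, hconj, hσ, map_sub, hRS]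
  have hconjx : conj ((algebraMap R L p + algebraMap R L q * t) / algebraMap R L d)
      = (algebraMap R L p + algebraMap R L q * (algebraMap R L b - t)) / algebraMap R L d := by
    simp only [map_div₀, map_add, map_mul, AlgHom.commutes, hconjt]
  rw [hconjx] at hyR
  have htr : d ∣ 2 * p + q * b := by
    apply dvd_of_isIntegral_div hinjL hd0
    have e : algebraMap R L (2 * p + q * b) / algebraMap R L d
        = ((algebraMap R L p + algebraMap R L q * t) / algebraMap R L d)
          + ((algebraMap R L p + algebraMap R L q * (algebraMap R L b - t)) / algebraMap R L d) := by
      simp only [map_add, map_mul, map_ofNat]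
      ring
    rw [e]
    exact hxR.add hyR
  have hnm : d ^ 2 ∣ p ^ 2 + p * q * b + c * q ^ 2 := by
    apply dvd_of_isIntegral_div hinjL (pow_ne_zero 2 hd0)
    have e : algebraMap R L (p ^ 2 + p * q * b + c * q ^ 2) / algebraMap R L (d ^ 2)
        = ((algebraMap R L p + algebraMap R L q * t) / algebraMap R L d)
          * ((algebraMap R L p + algebraMap R L q * (algebraMap R L b - t)) / algebraMap R L d) := by
      rw [div_mul_div_comm]
      simp only [map_add, map_mul, map_pow]
      rw [← sq]
      congr 1
      linear_combination ((algebraMap R L q) ^ 2) * htL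
    rw [e]
    exact hxR.mul hyR
  have hq : d ∣ q := by
    apply dvd_of_sq_dvd_sq_mul_squarefree hΔ hd0
    have e : q ^ 2 * (b ^ 2 - 4 * c)
        = (2 * p + q * b) ^ 2 - 4 * (p ^ 2 + p * q * b + c * q ^ 2) := by ring
    rw [e]
    exact dvd_sub (pow_dvd_pow_of_dvd htr 2) (hnm.mul_left 4)
  have hp : d ∣ p := by
    have : d ∣ 2 * p := (dvd_add_left (hq.mul_right b)).1 htr
    exact (h2.dvd_mul_left).1 this
  obtain ⟨q', rfl⟩ := hq
  obtain ⟨p', rfl⟩ := hp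
  refine ⟨algebraMap R S p' + algebraMap R S q' * τ, ?_⟩
  rw [eq_div_iff hdL]
  simp only [map_add, map_mul, hRS, ← ht]
  ring

/-- The quadratic ring `R[T]/(T² - bT + c)` is a normal domain if its discriminant is squarefree
and not a unit. -/
theorem adjoinRoot_quadratic_normal {R : Type*} [CommRing R] [IsDomain R]
    [UniqueFactorizationMonoid R] (h2 : IsUnit (2 : R)) (b c : R)
    (hΔ : Squarefree (b ^ 2 - 4 * c)) (hΔu : ¬ IsUnit (b ^ 2 - 4 * c)) (F : Polynomial R)
    (hF : F = Polynomial.X ^ 2 - Polynomial.C b * Polynomial.X + Polynomial.C c) :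
    IsDomain (AdjoinRoot F) ∧ IsIntegrallyClosed (AdjoinRoot F) := by
  have hdeg : F.natDegree = 2 := by
    rw [hF]; compute_degree!
  have hmon : F.Monic := by
    rw [hF]; monicity!
  have hirr : Irreducible F := by
    rw [hmon.irreducible_iff_roots_eq_zero_of_degree_le_three hdeg.ge (by omega)]
    refine Multiset.eq_zero_of_forall_notMem fun r hr => ?_
    have hr' := (Polynomial.mem_roots'.1 hr).2
    rw [Polynomial.IsRoot, hF] at hr'
    simp only [Polynomial.eval_add, Polynomial.eval_sub, Polynomial.eval_pow, Polynomial.eval_mul,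
      Polynomial.eval_X, Polynomial.eval_C] at hr'
    have e : b ^ 2 - 4 * c = (2 * r - b) * (2 * r - b) := by linear_combination (-4) * hr'
    have hu : IsUnit (2 * r - b) := hΔ _ ⟨1, by rw [mul_one]; exact e⟩
    exact hΔu (e ▸ hu.mul hu)
  have hdom : IsDomain (AdjoinRoot F) := AdjoinRoot.isDomain_of_prime hirr.prime
  refine ⟨hdom, ?_⟩
  have hint : Algebra.IsIntegral R (AdjoinRoot F) := by
    have := hmon.finite_adjoinRoot
    infer_instance
  have hτ : (AdjoinRoot.root F) ^ 2
      = algebraMap R (AdjoinRoot F) b * AdjoinRoot.root F - algebraMap R (AdjoinRoot F) c := by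
    have h := AdjoinRoot.eval₂_root F
    replace h := (congrArg (Polynomial.eval₂ (AdjoinRoot.of F) (AdjoinRoot.root F)) hF).symm.trans h
    simp only [Polynomial.eval₂_add, Polynomial.eval₂_sub, Polynomial.eval₂_mul,
      Polynomial.eval₂_pow, Polynomial.eval₂_X, Polynomial.eval₂_C] at h
    simp only [AdjoinRoot.algebraMap_eq]
    linear_combination h
  have hroot : Polynomial.aeval (algebraMap R (AdjoinRoot F) b - AdjoinRoot.root F) F = 0 := by
    refine (congrArg (Polynomial.aeval (algebraMap R (AdjoinRoot F) b - AdjoinRoot.root F)) hF).trans ?_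
    simp only [map_add, map_sub, map_mul, map_pow, Polynomial.aeval_X, Polynomial.aeval_C]
    linear_combination hτ
  refine normal_of_quadratic (FractionRing (AdjoinRoot F))
    (AdjoinRoot.of.injective_of_degree_ne_zero ?_) h2 b c
    (AdjoinRoot.root F) hτ ?_
    (AdjoinRoot.liftAlgHom F (Algebra.ofId R _) (algebraMap R (AdjoinRoot F) b - AdjoinRoot.root F)
      hroot) ?_ hΔ
  · rw [Polynomial.degree_eq_natDegree hmon.ne_zero, hdeg]; norm_num
  · intro s
    obtain ⟨f, rfl⟩ := AdjoinRoot.mk_surjective s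
    have hlt : (f %ₘ F).natDegree ≤ 1 := by
      have := Polynomial.natDegree_modByMonic_lt f hmon (by rintro h; simp [h] at hdeg)
      omega
    obtain ⟨q, p, hqp⟩ := Polynomial.exists_eq_X_add_C_of_natDegree_le_one hlt
    refine ⟨p, q, ?_⟩
    rw [← Polynomial.modByMonic_add_div f F, hqp]
    simp [AdjoinRoot.algebraMap_eq, add_comm]
  · simp

/-- A common divisor of `x - a` and `y - b` is a unit. -/
theorem isUnit_of_dvd_dvd (p : MvPolynomial (Fin 2) ℂ) (a b : ℂ)
    (h0 : p ∣ X 0 - C a) (h1 : p ∣ X 1 - C b) : IsUnit p := by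
  have key : ∀ (i j : Fin 2) (e : ℂ), i ≠ j → p ∣ X j - C e → p.degreeOf i = 0 := by
    rintro i j e hij ⟨u, hu⟩
    have hne : (X j - C e : MvPolynomial (Fin 2) ℂ) ≠ 0 := by
      intro h
      have := congrArg (MvPolynomial.eval (fun _ => e + 1)) h
      simp at this
    have hd : (X j - C e : MvPolynomial (Fin 2) ℂ).degreeOf i = 0 := by
      have := degreeOf_sub_le i (X j) (C e : MvPolynomial (Fin 2) ℂ)
      rw [degreeOf_X_of_ne hij, degreeOf_C] at this
      simpa using this
    rw [hu] at hne hd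
    rw [degreeOf_mul_eq (left_ne_zero_of_mul hne) (right_ne_zero_of_mul hne)] at hd
    omega
  have hp0 : p ≠ 0 := by
    rintro rfl
    have := congrArg (MvPolynomial.eval (fun _ => a + 1)) (zero_dvd_iff.1 h0)
    simp at this
  have hv : p.vars = ∅ := by
    ext i
    have : p.degreeOf i = 0 := by
      fin_cases i
      · exact key 0 1 b (by decide) h1
      · exact key 1 0 a (by decide) h0
    classical
    rw [degreeOf_def, Multiset.count_eq_zero] at this
    simpa [vars_def] using this
  rw [vars_eq_empty_iff_eq_C] at hv
  rw [hv]
  refine IsUnit.map C (isUnit_iff_ne_zero.2 fun h => hp0 ?_)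
  rw [hv, h, map_zero]

/-- The discriminant `x² y² - 4 (x² + y² - 2 - k)` is squarefree. -/
theorem markoff_disc_squarefree (k : ℂ) :
    Squarefree ((X 0 * X 1) ^ 2 - 4 * (X 0 ^ 2 + X 1 ^ 2 - 2 - C k) :
      MvPolynomial (Fin 2) ℂ) := by
  set D : MvPolynomial (Fin 2) ℂ := (X 0 * X 1) ^ 2 - 4 * (X 0 ^ 2 + X 1 ^ 2 - 2 - C k) with hD
  have hD0 : D ≠ 0 := by
    intro h
    have e1 := congrArg (MvPolynomial.eval ![0, 0]) h
    have e2 := congrArg (MvPolynomial.eval ![1, 0]) h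
    simp [hD] at e1 e2
    have : (1 : ℂ) = 0 := by linear_combination e2 - e1
    norm_num at this
  rw [squarefree_iff_no_irreducibles hD0]
  intro p hp hdvd
  have hpp : Prime p := hp.prime
  have hder : ∀ i, p ∣ pderiv i D := by
    intro i
    obtain ⟨u, hu⟩ := hdvd
    rw [hu]
    simp only [Derivation.leibniz, smul_eq_mul]
    exact ⟨p * pderiv i u + 2 * u * pderiv i p, by ring⟩
  have hc : ∀ e : ℂ, e ≠ 0 → IsUnit (C e : MvPolynomial (Fin 2) ℂ) := fun e he =>
    IsUnit.map C (isUnit_iff_ne_zero.2 he)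
  have u2 : ¬ p ∣ 2 := fun h => hp.not_isUnit (isUnit_of_dvd_unit h (by
    have := hc 2 (by norm_num)
    rwa [map_ofNat C 2] at this))
  have d0 : pderiv 0 D = 2 * (X 0 * ((X 1 - C 2) * (X 1 - C (-2)))) := by
    have e4 : (C 4 : MvPolynomial (Fin 2) ℂ) = 4 := map_ofNat C 4
    have e2 : (C 2 : MvPolynomial (Fin 2) ℂ) = 2 := map_ofNat C 2
    rw [hD, ← e4, ← e2]
    simp [Derivation.leibniz, pderiv_X]
    rw [e4, e2]
    ring
  have d1 : pderiv 1 D = 2 * (X 1 * ((X 0 - C 2) * (X 0 - C (-2)))) := by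
    have e4 : (C 4 : MvPolynomial (Fin 2) ℂ) = 4 := map_ofNat C 4
    have e2 : (C 2 : MvPolynomial (Fin 2) ℂ) = 2 := map_ofNat C 2
    rw [hD, ← e4, ← e2]
    simp [Derivation.leibniz, pderiv_X]
    rw [e4, e2]
    ring
  have h0 := hder 0
  have h1 := hder 1
  rw [d0] at h0
  rw [d1] at h1
  have h0' := (hpp.dvd_or_dvd h0).resolve_left u2
  have h1' := (hpp.dvd_or_dvd h1).resolve_left u2
  have hcon : ∀ (i : Fin 2) (a : ℂ), a ≠ 0 → p ∣ X i → ¬ p ∣ X i - C a := by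
    intro i a ha hi hia
    refine hp.not_isUnit (isUnit_of_dvd_unit ?_ (hc a ha))
    have := dvd_sub hi hia
    rwa [sub_sub_cancel] at this
  have hfin : ∀ a b : ℂ, p ∣ X 0 - C a → ¬ p ∣ X 1 - C b := fun a b ha hb =>
    hp.not_isUnit (isUnit_of_dvd_dvd p a b ha hb)
  have n2 : (2 : ℂ) ≠ 0 := by norm_num
  have n2' : (-2 : ℂ) ≠ 0 := by norm_num
  have q0 : ∃ a, p ∣ X 0 ∨ (a ≠ 0 ∧ p ∣ X 1 - C a) := by
    rcases hpp.dvd_or_dvd h0' with h | h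
    · exact ⟨0, Or.inl h⟩
    · rcases hpp.dvd_or_dvd h with h | h
      · exact ⟨2, Or.inr ⟨n2, h⟩⟩
      · exact ⟨-2, Or.inr ⟨n2', h⟩⟩
  have q1 : ∃ a, p ∣ X 1 ∨ (a ≠ 0 ∧ p ∣ X 0 - C a) := by
    rcases hpp.dvd_or_dvd h1' with h | h
    · exact ⟨0, Or.inl h⟩
    · rcases hpp.dvd_or_dvd h with h | h
      · exact ⟨2, Or.inr ⟨n2, h⟩⟩
      · exact ⟨-2, Or.inr ⟨n2', h⟩⟩
  obtain ⟨a, ha | ⟨ha0, ha⟩⟩ := q0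
  · obtain ⟨b, hb | ⟨hb0, hb⟩⟩ := q1
    · exact hfin 0 0 (by simpa using ha) (by simpa using hb)
    · exact hcon 0 b hb0 ha hb
  · obtain ⟨b, hb | ⟨hb0, hb⟩⟩ := q1
    · exact hcon 1 a ha0 hb ha
    · exact hfin b a hb ha

/-- The discriminant is not a unit, since it has a zero. -/
theorem markoff_disc_not_isUnit (k : ℂ) :
    ¬ IsUnit ((X 0 * X 1) ^ 2 - 4 * (X 0 ^ 2 + X 1 ^ 2 - 2 - C k) :
      MvPolynomial (Fin 2) ℂ) := by
  intro h
  obtain ⟨z, hz⟩ := IsAlgClosed.exists_pow_nat_eq (2 + k) (n := 2) (by norm_num)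
  have h' := h.map (MvPolynomial.eval ![0, z])
  simp [hz] at h'

/-- For every `k ∈ ℂ`, the ring `ℂ[x,y,z]/(x² + y² + z² − xyz − 2 − k)` is a normal
domain (an integrally closed integral domain). -/
theorem markoff_surface_normal (k : ℂ) :
    IsDomain (MvPolynomial (Fin 3) ℂ ⧸
      Ideal.span {(X 0 ^ 2 + X 1 ^ 2 + X 2 ^ 2 - X 0 * X 1 * X 2 - 2 - C k :
        MvPolynomial (Fin 3) ℂ)}) ∧
    IsIntegrallyClosed (MvPolynomial (Fin 3) ℂ ⧸
      Ideal.span {(X 0 ^ 2 + X 1 ^ 2 + X 2 ^ 2 - X 0 * X 1 * X 2 - 2 - C k :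
        MvPolynomial (Fin 3) ℂ)}) := by
  have h2 : IsUnit (2 : MvPolynomial (Fin 2) ℂ) := by
    have : IsUnit (C 2 : MvPolynomial (Fin 2) ℂ) :=
      IsUnit.map C (isUnit_iff_ne_zero.2 (by norm_num))
    rwa [map_ofNat C 2] at this
  obtain ⟨hdom, hint⟩ := adjoinRoot_quadratic_normal h2 (X 0 * X 1)
    (X 0 ^ 2 + X 1 ^ 2 - 2 - C k) (markoff_disc_squarefree k) (markoff_disc_not_isUnit k) _ rfl
  set F : Polynomial (MvPolynomial (Fin 2) ℂ) := Polynomial.X ^ 2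
    - Polynomial.C (X 0 * X 1) * Polynomial.X + Polynomial.C (X 0 ^ 2 + X 1 ^ 2 - 2 - C k) with hF
  have hmap : finSuccEquiv ℂ 2 (X 0 ^ 2 + X 1 ^ 2 + X 2 ^ 2 - X 0 * X 1 * X 2 - 2 - C k) = F := by
    have e1 : finSuccEquiv ℂ 2 (X 1) = Polynomial.C (X 0) := finSuccEquiv_X_succ (j := 0)
    have e2 : finSuccEquiv ℂ 2 (X 2) = Polynomial.C (X 1) := finSuccEquiv_X_succ (j := 1)
    have e3 : finSuccEquiv ℂ 2 (C k) = Polynomial.C (C k) := (finSuccEquiv ℂ 2).commutes k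
    simp only [map_add, map_sub, map_mul, map_pow, map_ofNat, finSuccEquiv_X_zero, e1, e2, e3, hF]
    ring
  let e := Ideal.quotientEquiv
    (Ideal.span {(X 0 ^ 2 + X 1 ^ 2 + X 2 ^ 2 - X 0 * X 1 * X 2 - 2 - C k :
        MvPolynomial (Fin 3) ℂ)}) (Ideal.span {F}) (finSuccEquiv ℂ 2).toRingEquiv (by
      rw [Ideal.map_span, Set.image_singleton]
      exact congrArg (fun t => Ideal.span {t}) hmap.symm)
  have hdom' : IsDomain (Polynomial (MvPolynomial (Fin 2) ℂ) ⧸ Ideal.span {F}) := hdom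
  have hint' : IsIntegrallyClosed (Polynomial (MvPolynomial (Fin 2) ℂ) ⧸ Ideal.span {F}) := hint
  exact ⟨e.toMulEquiv.isDomain _, IsIntegrallyClosed.of_equiv
    (R := Polynomial (MvPolynomial (Fin 2) ℂ) ⧸ Ideal.span {F}) e.symm⟩
end

section
/- For every (k₁, k₂, k₃, k₄) ∈ ℂ⁴, setting a = k₁k₂ + k₃k₄, b = k₂k₃ + k₁k₄, c = k₁k₃ + k₂k₄, and d = 4 − k₁² − k₂² − k₃² − k₄² − k₁k₂k₃k₄, the quotient ring ℂ[x,y,z]/(x² + y² + z² + xyz − ax − by − cz − d) is an integrally closed integral domain (i.e., a normal domain). -/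
theorem aux_dvd_of_sq {B : Type*} [CommRing B] [IsDomain B] [UniqueFactorizationMonoid B]
    {D q r : B} (hD : Squarefree D) (hr : r ≠ 0) (h : r ^ 2 ∣ q ^ 2 * D) : r ∣ q := by
  obtain ⟨r', q', g, hrel, rfl, rfl⟩ := UniqueFactorizationMonoid.exists_reduced_factors r hr q
  have hg : g ≠ 0 := by rintro rfl; simp at hr
  have h1 : r' ^ 2 ∣ q' ^ 2 * D := by
    rw [mul_pow, mul_pow, mul_assoc] at h
    exact (mul_dvd_mul_iff_left (pow_ne_zero 2 hg)).1 h
  have h2 : r' ^ 2 ∣ D := (hrel.pow).dvd_of_dvd_mul_left h1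
  have h3 : IsUnit r' := hD r' (by rwa [← sq])
  exact mul_dvd_mul_left g h3.dvd

theorem aux_integral {B L : Type*} [CommRing B] [IsDomain B] [IsIntegrallyClosed B]
    [Field L] [Algebra B L] [FaithfulSMul B L] {n r : B} (hr : r ≠ 0) {x : L}
    (hx : IsIntegral B x) (h : x * algebraMap B L r = algebraMap B L n) : r ∣ n := by
  let _ := FractionRing.liftAlgebra B L
  have hinj : Function.Injective (algebraMap (FractionRing B) L) := RingHom.injective _
  have hrL : algebraMap B L r ≠ 0 := by
    simpa using hr
  have hrK : algebraMap B (FractionRing B) r ≠ 0 := by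
    simpa using hr
  have hx' : x = algebraMap (FractionRing B) L
      (algebraMap B (FractionRing B) n / algebraMap B (FractionRing B) r) := by
    rw [map_div₀, ← IsScalarTower.algebraMap_apply, ← IsScalarTower.algebraMap_apply,
      eq_div_iff hrL, h]
  rw [hx', isIntegral_algebraMap_iff hinj] at hx
  obtain ⟨y, hy⟩ := IsIntegrallyClosed.isIntegral_iff.1 hx
  rw [eq_div_iff hrK, ← map_mul] at hy
  exact ⟨y, by rw [mul_comm]; exact (IsFractionRing.injective B (FractionRing B) hy).symm⟩

theorem aux_normal {B : Type*} [CommRing B] [IsDomain B] [UniqueFactorizationMonoid B]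
    (h2 : IsUnit (2 : B)) (b c : B) (hD : Squarefree (b ^ 2 - 4 * c))
    (hDu : ¬ IsUnit (b ^ 2 - 4 * c)) :
    IsDomain (AdjoinRoot (Polynomial.X ^ 2 + Polynomial.C b * Polynomial.X + Polynomial.C c)) ∧
    IsIntegrallyClosed
      (AdjoinRoot (Polynomial.X ^ 2 + Polynomial.C b * Polynomial.X + Polynomial.C c)) := by
  generalize hf : Polynomial.X ^ 2 + Polynomial.C b * Polynomial.X + Polynomial.C c = f
  have hdeg : f.natDegree = 2 := by rw [← hf]; compute_degree!
  have hmon : f.Monic := by rw [← hf]; monicity!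
  have hirr : Irreducible f := by
    by_contra hcon
    rw [hmon.not_irreducible_iff_exists_add_mul_eq_coeff hdeg] at hcon
    obtain ⟨r, s, h0, h1⟩ := hcon
    have e0 : f.coeff 0 = c := by rw [← hf]; simp
    have e1 : f.coeff 1 = b := by rw [← hf]; simp
    rw [e0] at h0
    rw [e1] at h1
    have : b ^ 2 - 4 * c = (r - s) * (r - s) := by rw [h0, h1]; ring
    have hu := hD (r - s) (by rw [this])
    exact hDu (this ▸ hu.mul hu)
  have hdom : IsDomain (AdjoinRoot f) := AdjoinRoot.isDomain_of_prime hirr.prime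
  refine ⟨hdom, ?_⟩
  have hfin := hmon.finite_adjoinRoot
  have hinj : Function.Injective (algebraMap B (AdjoinRoot f)) :=
    AdjoinRoot.of.injective_of_degree_ne_zero
      (by rw [Polynomial.degree_eq_natDegree hmon.ne_zero, hdeg]; decide)
  have hfaith : FaithfulSMul B (AdjoinRoot f) :=
    (faithfulSMul_iff_algebraMap_injective _ _).2 hinj
  set ι := algebraMap B (AdjoinRoot f) with hι
  set ζ := AdjoinRoot.root f with hζ
  have hroot : ζ ^ 2 + ι b * ζ + ι c = 0 := by
    have h := AdjoinRoot.eval₂_root f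
    have h' : (Polynomial.X ^ 2 + Polynomial.C b * Polynomial.X + Polynomial.C c).eval₂
        (AdjoinRoot.of f) (AdjoinRoot.root f) = 0 := by rw [hf]; exact h
    simp only [Polynomial.eval₂_add, Polynomial.eval₂_mul, Polynomial.eval₂_pow,
      Polynomial.eval₂_X, Polynomial.eval₂_C] at h'
    exact h'
  have hrep : ∀ a : AdjoinRoot f, ∃ p q : B, a = ι p + ι q * ζ := by
    intro a
    obtain ⟨g, rfl⟩ := AdjoinRoot.mk_surjective a
    rw [← AdjoinRoot.mk_leftInverse hmon (AdjoinRoot.mk f g)]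
    have hlt : (AdjoinRoot.modByMonicHom hmon (AdjoinRoot.mk f g)).natDegree ≤ 1 := by
      rw [AdjoinRoot.modByMonicHom_mk]
      have := Polynomial.natDegree_modByMonic_lt g hmon (by
        intro h; rw [h] at hdeg; simp at hdeg)
      omega
    obtain ⟨q, p, hpq⟩ := Polynomial.exists_eq_X_add_C_of_natDegree_le_one hlt
    refine ⟨p, q, ?_⟩
    rw [hpq]
    simp [add_comm, hι, hζ, AdjoinRoot.algebraMap_eq]
  have hσ0 : f.eval₂ (Algebra.ofId B (AdjoinRoot f)) (-ι b - ζ) = 0 := by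
    have h' : (Polynomial.X ^ 2 + Polynomial.C b * Polynomial.X + Polynomial.C c).eval₂
        (ι : B →+* AdjoinRoot f) (-ι b - ζ) = 0 := by
      simp only [Polynomial.eval₂_add, Polynomial.eval₂_mul, Polynomial.eval₂_pow,
        Polynomial.eval₂_X, Polynomial.eval₂_C]
      linear_combination hroot
    rw [hf] at h'
    exact h'
  let σ : AdjoinRoot f →ₐ[B] AdjoinRoot f :=
    AdjoinRoot.liftAlgHom f (Algebra.ofId B (AdjoinRoot f)) (-ι b - ζ) hσ0
  have hσζ : σ ζ = -ι b - ζ := AdjoinRoot.liftAlgHom_root ..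
  have hσι : ∀ p, σ (ι p) = ι p := fun p => σ.commutes p
  have hσσ : ∀ a, σ (σ a) = a := by
    intro a
    obtain ⟨p, q, rfl⟩ := hrep a
    simp only [map_add, map_mul, hσι, hσζ, map_sub, map_neg]
    ring
  have hσinj : Function.Injective σ := Function.LeftInverse.injective hσσ
  let L := FractionRing (AdjoinRoot f)
  let τ : L →ₐ[B] L := IsFractionRing.liftAlgHom (K := L)
    (g := (IsScalarTower.toAlgHom B (AdjoinRoot f) L).comp σ)
    ((IsFractionRing.injective (AdjoinRoot f) L).comp hσinj)
  have hτ : ∀ a, τ (algebraMap _ L a) = algebraMap _ L (σ a) := by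
    intro a
    exact IsFractionRing.lift_algebraMap (K := L) (g := (((IsScalarTower.toAlgHom B (AdjoinRoot f) L).comp σ : AdjoinRoot f →ₐ[B] L) : AdjoinRoot f →+* L))
      ((IsFractionRing.injective (AdjoinRoot f) L).comp hσinj) a
  have hLinj := IsFractionRing.injective (AdjoinRoot f) L
  rw [isIntegrallyClosed_iff L]
  intro w hw
  have hwB : IsIntegral B w := isIntegral_trans (R := B) (A := AdjoinRoot f) w hw
  -- write w with denominator in B
  obtain ⟨p, q, r, hr, hwr⟩ : ∃ p q r : B, r ≠ 0 ∧
      w * algebraMap B L r = algebraMap _ L (ι p + ι q * ζ) := by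
    obtain ⟨n, δ, hδ, rfl⟩ := IsFractionRing.div_surjective (A := AdjoinRoot f) w
    have hδ0 : δ ≠ 0 := nonZeroDivisors.ne_zero hδ
    obtain ⟨s, t, hst⟩ := hrep δ
    obtain ⟨p, q, hpq⟩ := hrep (n * σ δ)
    have hN : δ * σ δ = ι (s ^ 2 - s * t * b + t ^ 2 * c) := by
      rw [hst]
      simp only [map_add, map_mul, hσι, hσζ, map_sub, map_pow]
      linear_combination -(ι t) ^ 2 * hroot
    refine ⟨p, q, s ^ 2 - s * t * b + t ^ 2 * c, ?_, ?_⟩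
    · intro h0
      rw [h0, map_zero] at hN
      rcases mul_eq_zero.1 hN with h | h
      · exact hδ0 h
      · exact hδ0 (hσinj (by rw [h, map_zero]))
    · have : algebraMap (AdjoinRoot f) L δ ≠ 0 := by simpa using hδ0
      rw [IsScalarTower.algebraMap_apply B (AdjoinRoot f) L, ← hι, ← hN, ← hpq, map_mul, map_mul]
      rw [← mul_assoc, div_mul_cancel₀ _ this]
  have hτw : τ w * algebraMap B L r = algebraMap _ L (ι p + ι q * (-ι b - ζ)) := by
    have := congrArg τ hwr
    rw [map_mul, hτ, AlgHom.commutes] at this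
    simpa only [map_add, map_mul, hσι, hσζ] using this
  have hτint : IsIntegral B (τ w) := hwB.map τ
  have ht : ∀ y, algebraMap B L y = algebraMap (AdjoinRoot f) L (ι y) := fun y =>
    IsScalarTower.algebraMap_apply B (AdjoinRoot f) L y
  have d1 : r ∣ 2 * p - q * b := by
    refine aux_integral (L := L) hr (hwB.add hτint) ?_
    rw [add_mul, hwr, hτw, ht, ← map_add]
    congr 1
    simp only [map_sub, map_mul, map_ofNat]
    ring
  have d2 : r ^ 2 ∣ q ^ 2 * (b ^ 2 - 4 * c) := by
    refine aux_integral (L := L) (pow_ne_zero 2 hr) ((hwB.sub hτint).pow 2) ?_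
    rw [map_pow, ← mul_pow, sub_mul, hwr, hτw, ht, ← map_sub, ← map_pow]
    congr 1
    simp only [map_sub, map_mul, map_pow, map_ofNat]
    linear_combination 4 * (ι q) ^ 2 * hroot
  have d3 : r ∣ q := aux_dvd_of_sq hD hr d2
  have d4 : r ∣ p := by
    have : r ∣ 2 * p := by
      have := dvd_add d1 (d3.mul_right b)
      simpa using this
    exact (h2.dvd_mul_left).1 this
  obtain ⟨q', rfl⟩ := d3
  obtain ⟨p', rfl⟩ := d4
  refine ⟨ι p' + ι q' * ζ, ?_⟩
  have hrL : algebraMap B L r ≠ 0 := by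
    rw [ht]
    intro h
    exact hr (hinj (hLinj (by rw [h, map_zero, map_zero])))
  apply mul_right_cancel₀ hrL
  rw [hwr, ht, ← map_mul]
  congr 1
  simp only [map_mul]
  ring

open Polynomial in
theorem aux_coeff {R : Type*} [CommRing R] (u v w : R) :
    (C u * X ^ 2 + C v * X + C w).coeff 2 = u ∧ (C u * X ^ 2 + C v * X + C w).coeff 1 = v ∧
    (C u * X ^ 2 + C v * X + C w).coeff 0 = w := by
  refine ⟨?_, ?_, ?_⟩ <;> simp [coeff_X, coeff_C]

open Polynomial in
theorem aux_disc (a b c d : ℂ) :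
    ∀ D : ℂ[X][X], D = (X * C X - C (C a)) ^ 2 - 4 *
      (X ^ 2 + (C X) ^ 2 - C (C b) * X - C (C c) * C X - C (C d)) →
    Squarefree D ∧ ¬ IsUnit D := by
  intro D hD
  set α : ℂ[X] := X ^ 2 - C 4 with hα
  have hαm : α.Monic := by rw [hα]; monicity!
  have hαd : α.natDegree = 2 := by rw [hα]; compute_degree!
  have hαsq : Squarefree α := by
    apply Polynomial.Separable.squarefree
    exact Polynomial.separable_X_pow_sub_C (4 : ℂ) (by norm_num) (by norm_num)
  set β : ℂ[X] := C (4 * b) - C (2 * a) * X with hβ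
  set γ : ℂ[X] := C (-4) * X ^ 2 + C (4 * c) * X + C (a ^ 2 + 4 * d) with hγ
  have hDD : D = C α * X ^ 2 + C β * X + C γ := by
    rw [hD, hα, hβ, hγ]
    simp only [map_sub, map_add, map_mul, map_pow, map_ofNat, map_neg]
    ring
  have c2 : D.coeff 2 = α := by rw [hDD, (aux_coeff _ _ _).1]
  have c1 : D.coeff 1 = β := by rw [hDD, (aux_coeff _ _ _).2.1]
  have c0 : D.coeff 0 = γ := by rw [hDD, (aux_coeff _ _ _).2.2]
  have hγ2 : γ.coeff 2 = -4 := by rw [hγ, (aux_coeff _ _ _).1]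
  have hdeg : D.natDegree = 2 := by
    rw [hDD]; exact natDegree_quadratic hαm.ne_zero
  have hD0 : D ≠ 0 := by rintro rfl; simp at hdeg
  refine ⟨?_, fun hu => by have := natDegree_eq_zero_of_isUnit hu; omega⟩
  rintro p ⟨q, hq⟩
  have hp0 : p ≠ 0 := by rintro rfl; simp at hq; exact hD0 hq
  have hq0 : q ≠ 0 := by rintro rfl; simp at hq; exact hD0 hq
  have hdd : 2 = p.natDegree + p.natDegree + q.natDegree := by
    rw [← hdeg, hq, natDegree_mul (mul_ne_zero hp0 hp0) hq0, natDegree_mul hp0 hp0]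
  have hcase : p.natDegree = 0 ∨ (p.natDegree = 1 ∧ q.natDegree = 0) := by omega
  rcases hcase with h | ⟨h, h'⟩
  · obtain ⟨u, rfl⟩ := natDegree_eq_zero.1 h
    have : u * u ∣ α := by
      rw [← c2, hq, ← C_mul, coeff_C_mul]; exact dvd_mul_right _ _
    exact (hαsq u this).map C
  · exfalso
    obtain ⟨u, rfl⟩ := natDegree_eq_zero.1 h'
    obtain ⟨s, t, rfl⟩ := exists_eq_X_add_C_of_natDegree_le_one h.le
    have e : D = C (s * s * u) * X ^ 2 + C (2 * s * t * u) * X + C (t * t * u) := by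
      rw [hq]; simp only [map_mul, map_ofNat]; ring
    have e2 : α = s * s * u := by rw [← c2, e, (aux_coeff _ _ _).1]
    have e1 : β = 2 * s * t * u := by rw [← c1, e, (aux_coeff _ _ _).2.1]
    have e0 : γ = t * t * u := by rw [← c0, e, (aux_coeff _ _ _).2.2]
    have hs : IsUnit s := hαsq s ⟨u, e2⟩
    have hs0 : s ≠ 0 := hs.ne_zero
    have hdiv : α ∣ β := by
      obtain ⟨v, hv⟩ := hs.exists_right_inv
      refine ⟨2 * t * v, ?_⟩
      rw [e1, e2]
      linear_combination (-2 * s * t * u) * hv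
    have hβd : β.natDegree ≤ 1 := by rw [hβ]; compute_degree
    have hβ0 : β = 0 := by
      by_contra hne
      have := natDegree_le_of_dvd hdiv hne
      omega
    have hu0 : u ≠ 0 := by rintro rfl; simp at e2; exact hαm.ne_zero e2
    have ht0 : t = 0 := by
      rw [hβ0] at e1
      simpa [hs0, hu0] using e1.symm
    rw [e0, ht0] at hγ2
    simp at hγ2

open Polynomial in
theorem aux_isUnit_two : IsUnit (2 : ℂ[X][X]) := by
  have h : IsUnit (2 : ℂ) := by simp
  have h' := (h.map (C : ℂ →+* ℂ[X])).map (C : ℂ[X] →+* ℂ[X][X])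
  rwa [map_ofNat, map_ofNat] at h'

theorem aux_transfer {R S : Type*} [CommRing R] [CommRing S] (e : R ≃+* S) (F : R) (G : S)
    (h : e F = G) (hG : IsDomain (S ⧸ Ideal.span {G}) ∧ IsIntegrallyClosed (S ⧸ Ideal.span {G})) :
    IsDomain (R ⧸ Ideal.span {F}) ∧ IsIntegrallyClosed (R ⧸ Ideal.span {F}) := by
  obtain ⟨hdom, hcl⟩ := hG
  let e' : (R ⧸ Ideal.span {F}) ≃+* (S ⧸ Ideal.span {G}) :=
    Ideal.quotientEquiv (Ideal.span {F}) (Ideal.span {G}) e (by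
      rw [Ideal.map_span, Set.image_singleton, ← h]; rfl)
  exact ⟨e'.toMulEquiv.isDomain_iff.2 hdom, IsIntegrallyClosed.of_equiv e'.symm⟩

open MvPolynomial

/-- The identification of `ℂ[z,x,y]` with `ℂ[y][x][z]`. -/
noncomputable def auxEquiv : MvPolynomial (Fin 3) ℂ ≃ₐ[ℂ]
    Polynomial (Polynomial (Polynomial ℂ)) :=
  (finSuccEquiv ℂ 2).trans (Polynomial.mapAlgEquiv
    ((finSuccEquiv ℂ 1).trans (Polynomial.mapAlgEquiv (uniqueAlgEquiv ℂ (Fin 1)))))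

theorem auxEquiv_X0 : auxEquiv (X 0) = Polynomial.X := by
  simp [auxEquiv, finSuccEquiv_X_zero]

theorem auxEquiv_X1 : auxEquiv (X 1) = Polynomial.C Polynomial.X := by
  have h : finSuccEquiv ℂ 2 (X 1) = Polynomial.C (X 0) := finSuccEquiv_X_succ (j := 0)
  simp only [auxEquiv, AlgEquiv.trans_apply, h]
  simp [finSuccEquiv_X_zero]

theorem auxEquiv_X2 : auxEquiv (X 2) = Polynomial.C (Polynomial.C Polynomial.X) := by
  have h : finSuccEquiv ℂ 2 (X 2) = Polynomial.C (X 1) := finSuccEquiv_X_succ (j := 1)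
  have h' : finSuccEquiv ℂ 1 (X 1) = Polynomial.C (X 0) := finSuccEquiv_X_succ (j := 0)
  simp only [auxEquiv, AlgEquiv.trans_apply, h]
  simp [h', uniqueAlgEquiv]

theorem auxEquiv_C (a : ℂ) :
    auxEquiv (C a) = Polynomial.C (Polynomial.C (Polynomial.C a)) :=
  auxEquiv.commutes a

theorem aux_main (a b c d : ℂ) :
    IsDomain (MvPolynomial (Fin 3) ℂ ⧸
      Ideal.span {(X 0 ^ 2 + X 1 ^ 2 + X 2 ^ 2 + X 0 * X 1 * X 2
        - C a * X 0 - C b * X 1 - C c * X 2 - C d : MvPolynomial (Fin 3) ℂ)}) ∧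
    IsIntegrallyClosed (MvPolynomial (Fin 3) ℂ ⧸
      Ideal.span {(X 0 ^ 2 + X 1 ^ 2 + X 2 ^ 2 + X 0 * X 1 * X 2
        - C a * X 0 - C b * X 1 - C c * X 2 - C d : MvPolynomial (Fin 3) ℂ)}) := by
  obtain ⟨h1, h2⟩ := aux_disc a b c d _ rfl
  refine aux_transfer auxEquiv.toRingEquiv _ _ ?_ (aux_normal aux_isUnit_two _ _ h1 h2)
  change auxEquiv _ = _
  simp only [map_add, map_sub, map_mul, map_pow, auxEquiv_X0, auxEquiv_X1, auxEquiv_X2,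
    auxEquiv_C]
  ring

/-- For every `(k₁,k₂,k₃,k₄) ∈ ℂ⁴`, with `a = k₁k₂ + k₃k₄`, `b = k₂k₃ + k₁k₄`,
`c = k₁k₃ + k₂k₄`, `d = 4 − k₁² − k₂² − k₃² − k₄² − k₁k₂k₃k₄`, the ring
`ℂ[x,y,z]/(x² + y² + z² + xyz − ax − by − cz − d)` is a normal domain. -/
theorem four_holed_sphere_surface_normal (k₁ k₂ k₃ k₄ : ℂ) :
    IsDomain (MvPolynomial (Fin 3) ℂ ⧸
      Ideal.span {(X 0 ^ 2 + X 1 ^ 2 + X 2 ^ 2 + X 0 * X 1 * X 2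
        - C (k₁ * k₂ + k₃ * k₄) * X 0 - C (k₂ * k₃ + k₁ * k₄) * X 1
        - C (k₁ * k₃ + k₂ * k₄) * X 2
        - C (4 - k₁ ^ 2 - k₂ ^ 2 - k₃ ^ 2 - k₄ ^ 2 - k₁ * k₂ * k₃ * k₄) :
        MvPolynomial (Fin 3) ℂ)}) ∧
    IsIntegrallyClosed (MvPolynomial (Fin 3) ℂ ⧸
      Ideal.span {(X 0 ^ 2 + X 1 ^ 2 + X 2 ^ 2 + X 0 * X 1 * X 2
        - C (k₁ * k₂ + k₃ * k₄) * X 0 - C (k₂ * k₃ + k₁ * k₄) * X 1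
        - C (k₁ * k₃ + k₂ * k₄) * X 2
        - C (4 - k₁ ^ 2 - k₂ ^ 2 - k₃ ^ 2 - k₄ ^ 2 - k₁ * k₂ * k₃ * k₄) :
        MvPolynomial (Fin 3) ℂ)}) := by
  exact aux_main _ _ _ _
end

section
/- Let m ≥ 1 be an integer, let R = ℂ[(X₁)₁₁, (X₁)₁₂, (X₁)₂₁, (X₁)₂₂, …, (X_m)₁₁, (X_m)₁₂, (X_m)₂₁, (X_m)₂₂, T] be the polynomial ring over ℂ in 4m + 1 variables, and for i = 1, …, m let E_i = (X_i)₁₁·(X_i)₂₂ − (X_i)₁₂·(X_i)₂₁ − T². Then the quotient ring R/(E₁, …, E_m) is an integrally closed integral domain (i.e., a normal domain). -/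
open MvPolynomial

/-- The polynomial ring `R = ℂ[(Xᵢ)ⱼₖ, T]` in `4m + 1` variables, where the variable
`Sum.inl (i, j, k)` is the `(j,k)` entry of the `i`-th generic 2×2 matrix `Xᵢ` and
`Sum.inr ()` is `T`. -/
noncomputable abbrev genericMatrixRing (m : ℕ) :=
  MvPolynomial ((Fin m × Fin 2 × Fin 2) ⊕ Unit) ℂ

/-- `Eᵢ = det Xᵢ − T² = (Xᵢ)₁₁(Xᵢ)₂₂ − (Xᵢ)₁₂(Xᵢ)₂₁ − T²`. -/
noncomputable def detMinusTsq (m : ℕ) (i : Fin m) : genericMatrixRing m :=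
  X (Sum.inl (i, 0, 0)) * X (Sum.inl (i, 1, 1))
    - X (Sum.inl (i, 0, 1)) * X (Sum.inl (i, 1, 0)) - X (Sum.inr ()) ^ 2

/-- polynomial rings over normal domains are normal -/
theorem mvFinNormal {B : Type} [CommRing B] [IsDomain B] [IsIntegrallyClosed B] (n : ℕ) :
    IsIntegrallyClosed (MvPolynomial (Fin n) B) := by
  induction n with
  | zero => exact IsIntegrallyClosed.of_equiv (MvPolynomial.isEmptyRingEquiv B (Fin 0)).symm
  | succ n ih => exact IsIntegrallyClosed.of_equiv (MvPolynomial.finSuccEquiv B n).symm.toRingEquiv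

/-- If `C` becomes, after inverting `x`, a localization of a normal domain `P`, then elements of
`Frac C` integral over `C` lie in `C[1/x]`. -/
theorem integral_pow_mul {P C K : Type} [CommRing P] [IsDomain P] [IsIntegrallyClosed P]
    [CommRing C] [IsDomain C] [Field K] [Algebra C K] [IsFractionRing C K]
    (ψ : P →+* C) (hψ : Function.Injective ψ) (x : P) (hx : x ≠ 0)
    (h : ∀ c : C, ∃ n : ℕ, ∃ p : P, ψ x ^ n * c = ψ p) (k : K) (hk : IsIntegral C k) :
    ∃ n : ℕ, ∃ c : C, algebraMap C K (ψ x) ^ n * k = algebraMap C K c := by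
  have hx' : ψ x ≠ 0 := by rwa [Ne, map_eq_zero_iff ψ hψ]
  have hle : Submonoid.powers (ψ x) ≤ nonZeroDivisors C := powers_le_nonZeroDivisors_of_noZeroDivisors hx'
  have hleP : Submonoid.powers x ≤ nonZeroDivisors P := powers_le_nonZeroDivisors_of_noZeroDivisors hx
  let D := Localization.Away (ψ x)
  have hinj : Function.Injective (algebraMap C D) := IsLocalization.injective D hle
  have : IsDomain D := IsLocalization.isDomain_localization hle
  let : Algebra P D := ((algebraMap C D).comp ψ).toAlgebra
  have hmap : ∀ p : P, algebraMap P D p = algebraMap C D (ψ p) := fun p => rfl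
  have : IsLocalization (Submonoid.powers x) D := by
    refine ⟨⟨?_, ?_, ?_⟩⟩
    · rintro ⟨_, n, rfl⟩
      simp only [hmap, map_pow]
      exact (IsLocalization.Away.algebraMap_isUnit (ψ x)).pow n
    · intro z
      obtain ⟨n, c, hc⟩ := IsLocalization.Away.surj (ψ x) z
      obtain ⟨m, p, hp⟩ := h c
      refine ⟨⟨p, ⟨x ^ (m + n), m + n, rfl⟩⟩, ?_⟩
      simp only [hmap, ← hp, map_mul, map_pow, ← hc]
      ring
    · intro a b hab
      refine ⟨1, ?_⟩
      rw [hψ (hinj hab)]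
  have : IsIntegrallyClosed D := isIntegrallyClosed_of_isLocalization (R := P) (S := D) (Submonoid.powers x) hleP
  let : Algebra D K := (IsLocalization.map (M := Submonoid.powers (ψ x)) (T := nonZeroDivisors C) K (RingHom.id C) hle).toAlgebra
  have : IsScalarTower C D K := IsScalarTower.of_algebraMap_eq (fun c => by
    exact (IsLocalization.map_eq (M := Submonoid.powers (ψ x)) (T := nonZeroDivisors C) (S := D) (Q := K)
      (g := RingHom.id C) hle c).symm)
  have : IsFractionRing D K := IsFractionRing.isFractionRing_of_isDomain_of_isLocalization (Submonoid.powers (ψ x)) D K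
  obtain ⟨d, hd⟩ := IsIntegrallyClosed.isIntegral_iff.mp (hk.tower_top (A := D))
  obtain ⟨n, c, hc⟩ := IsLocalization.Away.surj (ψ x) d
  refine ⟨n, c, ?_⟩
  rw [IsScalarTower.algebraMap_apply C D K c, ← hc, map_mul, hd, map_pow, ← IsScalarTower.algebraMap_apply C D K, mul_comm]

/-- the generic hypersurface equation -/
noncomputable def hypE {B : Type} [CommRing B] (f : B) : MvPolynomial (Fin 4) B :=
  X 0 * X 3 - X 1 * X 2 - C f

section hyp
variable {B A : Type} [CommRing B] [IsDomain B] [CommRing A]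

theorem X_not_dvd_of_constantCoeff (i : Fin 4) (p : MvPolynomial (Fin 4) B)
    (hp : constantCoeff p ≠ 0) : ¬ X i ∣ p := by
  rintro ⟨q, rfl⟩
  simp at hp

theorem hyp_nzd (f : B) (hf : f ≠ 0) (π : MvPolynomial (Fin 4) B →+* A)
    (hs : Function.Surjective π) (hπ : ∀ p, π p = 0 ↔ hypE f ∣ p) (a : A)
    (h : π (X 0) * a = 0) : a = 0 := by
  obtain ⟨p, rfl⟩ := hs a
  rw [← map_mul, hπ] at h
  obtain ⟨q, hq⟩ := h
  have hd : X 0 ∣ hypE f * q := ⟨p, hq.symm⟩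
  rcases (X_prime (i := (0 : Fin 4)) (R := B)).dvd_or_dvd hd with h1 | ⟨r, rfl⟩
  · exact absurd h1 (X_not_dvd_of_constantCoeff _ _ (by simp [hypE, hf]))
  · rw [hπ]
    refine ⟨r, ?_⟩
    apply mul_left_cancel₀ (X_ne_zero (R := B) (0 : Fin 4))
    rw [hq]; ring

theorem hyp_regular (f : B) (hf : f ≠ 0) (π : MvPolynomial (Fin 4) B →+* A)
    (hs : Function.Surjective π) (hπ : ∀ p, π p = 0 ↔ hypE f ∣ p) (a : A)
    (h : π (X 0) ∣ π (X 1) * a) : π (X 0) ∣ a := by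
  obtain ⟨p, rfl⟩ := hs a
  obtain ⟨b, hb⟩ := h
  obtain ⟨q, rfl⟩ := hs b
  rw [← map_mul, ← map_mul, ← sub_eq_zero, ← map_sub, hπ] at hb
  obtain ⟨r, hr⟩ := hb
  let ε : MvPolynomial (Fin 4) B →ₐ[B] MvPolynomial (Fin 4) B :=
    aeval (fun i => if i = 0 then 0 else X i)
  have hε : ∀ s, (X 0 : MvPolynomial (Fin 4) B) ∣ s - ε s := by
    intro s
    induction s using MvPolynomial.induction_on with
    | C b => simp [ε]
    | add s t hs ht =>
      rw [map_add, add_sub_add_comm]; exact dvd_add hs ht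
    | mul_X s i hs =>
      by_cases hi : i = 0
      · subst hi; simp [ε]
      · have : ε (X i) = X i := by simp [ε, hi]
        rw [map_mul, this, ← sub_mul]
        exact hs.mul_right _
  have hr' := congrArg ε hr
  have e0 : ε (X 0) = 0 := by simp [ε]
  have e1 : ε (X 1) = X 1 := by simp [ε]
  have e2 : ε (X 2) = X 2 := by simp [ε]
  have eC : ε (C f) = C f := by simp [ε]
  have eE : ε (hypE f) = - (X 1 * X 2 + C f) := by
    simp only [hypE, map_sub, map_mul, e0, e1, e2, eC]; ring
  rw [map_sub, map_mul, map_mul, map_mul, e0, e1, eE] at hr'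
  have hd : X 1 ∣ (X 1 * X 2 + C f) * ε r := ⟨- ε p, by linear_combination hr'⟩
  rcases (X_prime (i := (1 : Fin 4)) (R := B)).dvd_or_dvd hd with h1 | ⟨t, ht⟩
  · exact absurd h1 (X_not_dvd_of_constantCoeff _ _ (by simp [hf]))
  · have hp : ε p = - (X 1 * X 2 + C f) * t := by
      apply mul_left_cancel₀ (X_ne_zero (R := B) (1 : Fin 4))
      rw [ht] at hr'
      linear_combination hr'
    obtain ⟨u, hu⟩ := hε p
    have hp2 : p = X 0 * (u - X 3 * t) + hypE f * t := by
      rw [hypE]; linear_combination hu + hp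
    have h0 : π (hypE f) = 0 := (hπ _).2 dvd_rfl
    rw [hp2, map_add, map_mul, map_mul, h0, zero_mul, add_zero]
    exact dvd_mul_right _ _

/-- the inclusion of `B[x,y,z]` -/
noncomputable def hypPsi (π : MvPolynomial (Fin 4) B →+* A) : MvPolynomial (Fin 3) B →+* A :=
  π.comp (rename (Fin.castSucc : Fin 3 → Fin 4)).toRingHom

theorem hypPsi_X (π : MvPolynomial (Fin 4) B →+* A) (i : Fin 3) :
    hypPsi π (X i) = π (X i.castSucc) := by simp [hypPsi]

theorem hypPsi_C (π : MvPolynomial (Fin 4) B →+* A) (b : B) :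
    hypPsi π (C b) = π (C b) := by simp [hypPsi]

theorem hyp_pow_mul (f : B) (π : MvPolynomial (Fin 4) B →+* A)
    (hs : Function.Surjective π) (hπ : ∀ p, π p = 0 ↔ hypE f ∣ p) (a : A) :
    ∃ n : ℕ, ∃ p, hypPsi π (X 0) ^ n * a = hypPsi π p := by
  obtain ⟨q, rfl⟩ := hs a
  have h0 : π (hypE f) = 0 := (hπ _).2 dvd_rfl
  have hx : hypPsi π (X 0) = π (X 0) := hypPsi_X π 0
  induction q using MvPolynomial.induction_on with
  | C b => exact ⟨0, C b, by simp [hypPsi_C]⟩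
  | add s t hs ht =>
    obtain ⟨n, p, hp⟩ := hs
    obtain ⟨m, q, hq⟩ := ht
    refine ⟨n + m, X 0 ^ m * p + X 0 ^ n * q, ?_⟩
    simp only [map_add, map_mul, map_pow, ← hp, ← hq]
    ring
  | mul_X s i hs =>
    obtain ⟨n, p, hp⟩ := hs
    induction i using Fin.lastCases with
    | last =>
      refine ⟨n + 1, p * (X 1 * X 2 + C f), ?_⟩
      have e1 : hypPsi π (X 1) = π (X 1) := hypPsi_X π 1
      have e2 : hypPsi π (X 2) = π (X 2) := hypPsi_X π 2
      simp only [map_add, map_mul, ← hp, hypPsi_C, e1, e2]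
      have : π (X 0) * π (X (Fin.last 3)) = π (X 1) * π (X 2) + π (C f) := by
        simp only [hypE, map_sub, map_mul] at h0
        have e3 : (Fin.last 3) = (3 : Fin 4) := rfl
        rw [e3]
        linear_combination h0
      rw [← this, hx]
      ring
    | cast i =>
      refine ⟨n, p * X i, ?_⟩
      rw [map_mul, map_mul, ← hp, hypPsi_X π i]; ring

theorem hyp_exists_phi (f : B) (π : MvPolynomial (Fin 4) B →+* A)
    (hs : Function.Surjective π) (hπ : ∀ p, π p = 0 ↔ hypE f ∣ p) :
    ∃ φ : A →+* FractionRing (MvPolynomial (Fin 3) B),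
      ∀ p, φ (hypPsi π p) = algebraMap _ _ p := by
  let L := FractionRing (MvPolynomial (Fin 3) B)
  let ι : MvPolynomial (Fin 3) B →+* L := algebraMap _ _
  have hx : ι (X 0) ≠ 0 := by
    simpa [ι] using X_ne_zero (R := B) (0 : Fin 3)
  let v : Fin 4 → L := ![ι (X 0), ι (X 1), ι (X 2), (ι (X 1) * ι (X 2) + ι (C f)) / ι (X 0)]
  let g : MvPolynomial (Fin 4) B →+* L := eval₂Hom (ι.comp C) v
  have hgE : g (hypE f) = 0 := by
    have h3 : g (X 3) * ι (X 0) = ι (X 1) * ι (X 2) + ι (C f) := by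
      have : g (X 3) = (ι (X 1) * ι (X 2) + ι (C f)) / ι (X 0) := by simp [g, v]
      rw [this, div_mul_cancel₀ _ hx]
    have g0 : g (X 0) = ι (X 0) := by simp [g, v]
    have g1 : g (X 1) = ι (X 1) := by simp [g, v]
    have g2 : g (X 2) = ι (X 2) := by simp [g, v]
    have gC : g (C f) = ι (C f) := by simp [g]
    rw [hypE, map_sub, map_sub, map_mul, map_mul, g0, g1, g2, gC]
    linear_combination h3
  have hker : RingHom.ker π ≤ RingHom.ker g := by
    intro p hp
    obtain ⟨q, rfl⟩ := (hπ p).1 hp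
    rw [RingHom.mem_ker, map_mul, hgE, zero_mul]
  let φ := (π.liftOfSurjective hs) ⟨g, hker⟩
  have hφ : ∀ p, φ (π p) = g p := fun p => RingHom.liftOfRightInverse_comp_apply _ _ _ ⟨g, hker⟩ p
  refine ⟨φ, ?_⟩
  intro p
  have : φ.comp (hypPsi π) = ι := by
    ext i
    · simp [hypPsi_C, hφ, g]
    · rw [RingHom.comp_apply, hypPsi_X, hφ]
      fin_cases i <;> simp [g, v]
  exact RingHom.congr_fun this p

theorem hypPsi_injective (f : B) (π : MvPolynomial (Fin 4) B →+* A)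
    (hs : Function.Surjective π) (hπ : ∀ p, π p = 0 ↔ hypE f ∣ p) :
    Function.Injective (hypPsi π) := by
  obtain ⟨φ, hφ⟩ := hyp_exists_phi f π hs hπ
  intro p q h
  apply IsFractionRing.injective (MvPolynomial (Fin 3) B) (FractionRing (MvPolynomial (Fin 3) B))
  rw [← hφ, ← hφ, h]

theorem hyp_isDomain (f : B) (hf : f ≠ 0) (π : MvPolynomial (Fin 4) B →+* A)
    (hs : Function.Surjective π) (hπ : ∀ p, π p = 0 ↔ hypE f ∣ p) : IsDomain A := by
  obtain ⟨φ, hφ⟩ := hyp_exists_phi f π hs hπ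
  refine Function.Injective.isDomain φ ?_
  rw [injective_iff_map_eq_zero]
  intro a ha
  obtain ⟨n, p, hp⟩ := hyp_pow_mul f π hs hπ a
  have hp0 : p = 0 := by
    apply IsFractionRing.injective (MvPolynomial (Fin 3) B) (FractionRing (MvPolynomial (Fin 3) B))
    rw [← hφ, ← hp, map_mul, ha, mul_zero, map_zero]
  rw [hp0, map_zero, hypPsi_X] at hp
  clear hp0
  induction n with
  | zero => simpa using hp
  | succ n ih =>
    apply ih
    apply hyp_nzd f hf π hs hπ
    rw [← hp, pow_succ']
    exact (mul_assoc _ _ _).symm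

theorem hyp_integrallyClosed [IsIntegrallyClosed B] (f : B) (hf : f ≠ 0)
    (π : MvPolynomial (Fin 4) B →+* A)
    (hs : Function.Surjective π) (hπ : ∀ p, π p = 0 ↔ hypE f ∣ p) : IsIntegrallyClosed A := by
  have := hyp_isDomain f hf π hs hπ
  have := mvFinNormal (B := B) 3
  let K := FractionRing A
  let σ : Fin 4 ≃ Fin 4 := ⟨![1, 0, 3, 2], ![1, 0, 3, 2], by decide, by decide⟩
  let e := renameEquiv B σ
  let π' : MvPolynomial (Fin 4) B →+* A := π.comp (e : MvPolynomial (Fin 4) B →+* MvPolynomial (Fin 4) B)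
  have hs' : Function.Surjective π' := hs.comp e.surjective
  have heE : e (hypE (-f)) = - hypE f := by
    simp [e, hypE, σ]; ring
  have hπ' : ∀ p, π' p = 0 ↔ hypE (-f) ∣ p := by
    intro p
    rw [show π' p = π (e p) from rfl, hπ, ← map_dvd_iff e (a := hypE (-f)), heE, neg_dvd]
  have hx : hypPsi π (X 0) = π (X 0) := hypPsi_X π 0
  have hy : hypPsi π' (X 0) = π (X 1) := by
    rw [hypPsi_X]; simp [π', e, σ]
  have hx0 : π (X 0) ≠ 0 := by
    rw [← hx, Ne, map_eq_zero_iff _ (hypPsi_injective f π hs hπ)]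
    exact X_ne_zero _
  refine (isIntegrallyClosed_iff K).2 ?_
  intro k hk
  obtain ⟨n, a, ha⟩ := integral_pow_mul (hypPsi π) (hypPsi_injective f π hs hπ) (X 0)
    (X_ne_zero _) (hyp_pow_mul f π hs hπ) k hk
  obtain ⟨m, b, hb⟩ := integral_pow_mul (hypPsi π') (hypPsi_injective (-f) π' hs' hπ') (X 0)
    (X_ne_zero _) (hyp_pow_mul (-f) π' hs' hπ') k hk
  rw [hx] at ha
  rw [hy] at hb
  have hab : π (X 1) ^ m * a = π (X 0) ^ n * b := by
    apply IsFractionRing.injective A K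
    rw [map_mul, map_mul, map_pow, map_pow, ← ha, ← hb]; ring
  have key : ∀ (m : ℕ) (a : A), π (X 0) ∣ π (X 1) ^ m * a → π (X 0) ∣ a := by
    intro m
    induction m with
    | zero => intro a h; simpa using h
    | succ m ih =>
      intro a h
      apply hyp_regular f hf π hs hπ
      apply ih
      rwa [← mul_assoc, ← pow_succ]
  have key2 : ∀ (n : ℕ) (a b : A), π (X 1) ^ m * a = π (X 0) ^ n * b → π (X 0) ^ n ∣ a := by
    intro n
    induction n with
    | zero => intro a b _; simp
    | succ n ih =>
      intro a b h
      obtain ⟨a', rfl⟩ := key m a (by rw [h, pow_succ', mul_assoc]; exact dvd_mul_right _ _)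
      rw [pow_succ']
      apply mul_dvd_mul_left
      apply ih a' b
      apply mul_left_cancel₀ hx0
      linear_combination h
  obtain ⟨c, rfl⟩ := key2 n a b hab
  refine ⟨c, ?_⟩
  have hxK : algebraMap A K (π (X 0)) ^ n ≠ 0 :=
    pow_ne_zero _ (by rwa [Ne, map_eq_zero_iff _ (IsFractionRing.injective A K)])
  apply mul_left_cancel₀ hxK
  rw [ha, map_mul, map_pow]

theorem hyp_C_injective (f : B) (π : MvPolynomial (Fin 4) B →+* A)
    (hs : Function.Surjective π) (hπ : ∀ p, π p = 0 ↔ hypE f ∣ p) (b : B) (h : π (C b) = 0) :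
    b = 0 := by
  rw [← hypPsi_C, map_eq_zero_iff _ (hypPsi_injective f π hs hπ)] at h
  simpa using h

end hyp

/-- the quotient ring -/
abbrev RepRing (m : ℕ) := genericMatrixRing m ⧸ Ideal.span (Set.range (detMinusTsq m))

/-- generators -/
noncomputable def repX (m : ℕ) (i : Fin m) (j k : Fin 2) : RepRing m :=
  Ideal.Quotient.mk _ (X (Sum.inl (i, j, k)))

/-- the generator T -/
noncomputable def repT (m : ℕ) : RepRing m := Ideal.Quotient.mk _ (X (Sum.inr ()))

theorem rep_rel (m : ℕ) (i : Fin m) :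
    repX m i 0 0 * repX m i 1 1 - repX m i 0 1 * repX m i 1 0 - repT m ^ 2 = 0 := by
  have : (Ideal.Quotient.mk (Ideal.span (Set.range (detMinusTsq m)))) (detMinusTsq m i) = 0 :=
    Ideal.Quotient.eq_zero_iff_mem.2 (Ideal.subset_span ⟨i, rfl⟩)
  simpa [detMinusTsq, repX, repT] using this

/-- universal property -/
noncomputable def repLift (m : ℕ) {S : Type} [CommRing S] (c : ℂ →+* S)
    (x : Fin m → Fin 2 → Fin 2 → S) (t : S)
    (h : ∀ i, x i 0 0 * x i 1 1 - x i 0 1 * x i 1 0 - t ^ 2 = 0) : RepRing m →+* S :=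
  Ideal.Quotient.lift _ (eval₂Hom c (Sum.elim (fun q => x q.1 q.2.1 q.2.2) (fun _ => t))) (by
    intro a ha
    have : Ideal.span (Set.range (detMinusTsq m)) ≤ RingHom.ker
        (eval₂Hom c (Sum.elim (fun q : Fin m × Fin 2 × Fin 2 => x q.1 q.2.1 q.2.2) (fun _ => t))) := by
      rw [Ideal.span_le]
      rintro _ ⟨i, rfl⟩
      simpa [detMinusTsq] using h i
    exact this ha)

section lift
variable (m : ℕ) {S : Type} [CommRing S] (c : ℂ →+* S)
    (x : Fin m → Fin 2 → Fin 2 → S) (t : S)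
    (h : ∀ i, x i 0 0 * x i 1 1 - x i 0 1 * x i 1 0 - t ^ 2 = 0)

theorem repLift_X (i : Fin m) (j k : Fin 2) : repLift m c x t h (repX m i j k) = x i j k := by
  change (eval₂Hom c (Sum.elim (fun q : Fin m × Fin 2 × Fin 2 => x q.1 q.2.1 q.2.2) (fun _ => t))) (X (Sum.inl (i, j, k))) = _
  simp

theorem repLift_T : repLift m c x t h (repT m) = t := by
  change (eval₂Hom c (Sum.elim (fun q : Fin m × Fin 2 × Fin 2 => x q.1 q.2.1 q.2.2) (fun _ => t))) (X (Sum.inr ())) = _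
  simp

theorem repLift_C (z : ℂ) : repLift m c x t h (algebraMap ℂ _ z) = c z := by
  have : algebraMap ℂ (RepRing m) z = Ideal.Quotient.mk _ (C z) := rfl
  rw [this]
  change (eval₂Hom c (Sum.elim (fun q : Fin m × Fin 2 × Fin 2 => x q.1 q.2.1 q.2.2) (fun _ => t))) (C z) = _
  simp

theorem rep_hom_ext (g₁ g₂ : RepRing m →+* S)
    (hC : ∀ z : ℂ, g₁ (algebraMap ℂ _ z) = g₂ (algebraMap ℂ _ z))
    (hX : ∀ i j k, g₁ (repX m i j k) = g₂ (repX m i j k)) (hT : g₁ (repT m) = g₂ (repT m)) :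
    g₁ = g₂ := by
  apply Ideal.Quotient.ringHom_ext
  apply MvPolynomial.ringHom_ext
  · exact hC
  · rintro (⟨i, j, k⟩ | ⟨⟩)
    · exact hX i j k
    · exact hT
end lift

/-- the inclusion of the `m`-th ring in the next -/
noncomputable def repIncl (m : ℕ) : RepRing m →+* RepRing (m + 1) :=
  repLift m (algebraMap ℂ _) (fun i => repX (m + 1) i.castSucc) (repT (m + 1))
    (fun i => rep_rel (m + 1) i.castSucc)

/-- the presentation of the next ring over the `m`-th -/
noncomputable def repPi (m : ℕ) : MvPolynomial (Fin 4) (RepRing m) →+* RepRing (m + 1) :=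
  eval₂Hom (repIncl m) ![repX (m + 1) (Fin.last m) 0 0, repX (m + 1) (Fin.last m) 0 1,
    repX (m + 1) (Fin.last m) 1 0, repX (m + 1) (Fin.last m) 1 1]

theorem repPi_hypE (m : ℕ) : repPi m (hypE (repT m ^ 2)) = 0 := by
  have := rep_rel (m + 1) (Fin.last m)
  simpa [repPi, hypE, repIncl, repLift_T] using this

/-- matrix of the four variables -/
noncomputable def hypMat (B : Type) [CommRing B] (I : Ideal (MvPolynomial (Fin 4) B)) :
    Fin 2 → Fin 2 → MvPolynomial (Fin 4) B ⧸ I :=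
  ![![Ideal.Quotient.mk _ (X 0), Ideal.Quotient.mk _ (X 1)],
    ![Ideal.Quotient.mk _ (X 2), Ideal.Quotient.mk _ (X 3)]]

theorem rep_exists_inv (m : ℕ) :
    ∃ g : RepRing (m + 1) →+* MvPolynomial (Fin 4) (RepRing m) ⧸ Ideal.span {hypE (repT m ^ 2)},
      (∀ p, g (repPi m p) = Ideal.Quotient.mk _ p) ∧ Function.Surjective (repPi m) := by
  let I := Ideal.span {hypE (repT m ^ 2)}
  let Q := MvPolynomial (Fin 4) (RepRing m) ⧸ I
  let j : RepRing m →+* Q := (Ideal.Quotient.mk I).comp C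
  let x : Fin (m + 1) → Fin 2 → Fin 2 → Q :=
    Fin.snoc (α := fun _ => Fin 2 → Fin 2 → Q) (fun i k l => j (repX m i k l)) (hypMat _ I)
  have hxc : ∀ i : Fin m, x i.castSucc = fun k l => j (repX m i k l) := fun i => by simp [x]
  have hxl : x (Fin.last m) = hypMat _ I := by simp [x]
  have hrel : ∀ i, x i 0 0 * x i 1 1 - x i 0 1 * x i 1 0 - (j (repT m)) ^ 2 = 0 := by
    intro i
    induction i using Fin.lastCases with
    | last =>
      have : Ideal.Quotient.mk I (hypE (repT m ^ 2)) = 0 :=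
        Ideal.Quotient.eq_zero_iff_mem.2 (Ideal.subset_span rfl)
      rw [hxl]
      simpa [hypE, hypMat, j] using this
    | cast i =>
      rw [hxc]
      have := congrArg j (rep_rel m i)
      simpa only [map_sub, map_mul, map_pow, map_zero] using this
  let g : RepRing (m + 1) →+* Q := repLift (m + 1) (j.comp (algebraMap ℂ _)) x (j (repT m)) hrel
  have hgi : g.comp (repIncl m) = j := by
    apply rep_hom_ext
    · intro z; simp only [RingHom.comp_apply, repIncl, repLift_C, g]
    · intro i k l; simp only [RingHom.comp_apply, repIncl, repLift_X, g, hxc]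
    · simp only [RingHom.comp_apply, repIncl, repLift_T, g]
  have h1 : ∀ p, g (repPi m p) = Ideal.Quotient.mk I p := by
    intro p
    have : g.comp (repPi m) = Ideal.Quotient.mk I := by
      apply MvPolynomial.ringHom_ext
      · intro r
        have := RingHom.congr_fun hgi r
        simpa [repPi, j] using this
      · intro i
        fin_cases i <;> simp [repPi, g, repLift_X, hxl, hypMat]
    exact RingHom.congr_fun this p
  refine ⟨g, h1, ?_⟩
  let h : Q →+* RepRing (m + 1) := Ideal.Quotient.lift I (repPi m) (by
    intro a ha
    obtain ⟨b, rfl⟩ := Ideal.mem_span_singleton.1 ha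
    rw [map_mul, repPi_hypE, zero_mul])
  have hh : ∀ p, h (Ideal.Quotient.mk I p) = repPi m p := fun _ => rfl
  have hj : ∀ r, h (j r) = repIncl m r := by
    intro r; simp [j, hh, repPi]
  have h2 : h.comp g = RingHom.id _ := by
    apply rep_hom_ext
    · intro z; simp only [RingHom.comp_apply, repLift_C, g, hj, repIncl, RingHom.id_apply]
    · intro i k l
      induction i using Fin.lastCases with
      | last =>
        simp only [RingHom.comp_apply, repLift_X, g, hxl, RingHom.id_apply]
        fin_cases k <;> fin_cases l <;> simp [hypMat, hh, repPi]
      | cast i => simp only [RingHom.comp_apply, repLift_X, g, hxc, hj, repIncl, RingHom.id_apply]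
    · simp only [RingHom.comp_apply, repLift_T, g, hj, repIncl, RingHom.id_apply]
  intro a
  obtain ⟨p, hp⟩ := Ideal.Quotient.mk_surjective (g a)
  refine ⟨p, ?_⟩
  have := RingHom.congr_fun h2 a
  rw [RingHom.comp_apply, ← hp] at this
  simpa [hh] using this

theorem rep_all (m : ℕ) : IsDomain (RepRing m) ∧ IsIntegrallyClosed (RepRing m) ∧ repT m ≠ 0 := by
  induction m with
  | zero =>
    have hbot : Ideal.span (Set.range (detMinusTsq 0)) = ⊥ := by
      rw [Set.range_eq_empty, Ideal.span_empty]
    let e : RepRing 0 ≃+* genericMatrixRing 0 :=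
      (Ideal.quotEquivOfEq hbot).trans (RingEquiv.quotientBot _)
    have hd : IsDomain (RepRing 0) := e.toMulEquiv.isDomain _
    refine ⟨hd, IsIntegrallyClosed.of_equiv e.symm, ?_⟩
    intro h
    rw [repT, Ideal.Quotient.eq_zero_iff_mem, hbot, Ideal.mem_bot] at h
    exact X_ne_zero _ h
  | succ m ih =>
    obtain ⟨hd, hi, hT⟩ := ih
    obtain ⟨g, hg, hs⟩ := rep_exists_inv m
    have hf : repT m ^ 2 ≠ 0 := pow_ne_zero _ hT
    have hπ : ∀ p, repPi m p = 0 ↔ hypE (repT m ^ 2) ∣ p := by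
      intro p
      constructor
      · intro h
        have := hg p
        rw [h, map_zero] at this
        exact Ideal.mem_span_singleton.1 (Ideal.Quotient.eq_zero_iff_mem.1 this.symm)
      · rintro ⟨q, rfl⟩
        rw [map_mul, repPi_hypE, zero_mul]
    refine ⟨hyp_isDomain _ hf _ hs hπ, hyp_integrallyClosed _ hf _ hs hπ, ?_⟩
    intro h
    apply hT
    apply hyp_C_injective _ _ hs hπ
    simpa [repPi, repIncl, repLift_T] using h

/-- The quotient `R/(E₁, …, E_m)` is a normal domain. -/
theorem quotient_detMinusTsq_normal_domain (m : ℕ) (hm : 1 ≤ m) :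
    IsDomain (genericMatrixRing m ⧸ Ideal.span (Set.range (detMinusTsq m))) ∧
    IsIntegrallyClosed (genericMatrixRing m ⧸ Ideal.span (Set.range (detMinusTsq m))) :=
  ⟨(rep_all m).1, (rep_all m).2.1⟩
end

section
/- Let m ≥ 3 be an integer, and for 0 ≤ r ≤ m − 3 let N_m(r) denote the number of r-element sets of pairwise noncrossing diagonals of a convex m-gon (so N_m(0) = 1). Then the polynomial f_m(t) = Σ_{r=0}^{m−3} N_m(r)·t^r·(1 − t)^{m−3−r} in ℤ[t] has degree m − 3 and is palindromic: for every 0 ≤ r ≤ m − 3, the coefficient of t^r in f_m equals the coefficient of t^{m−3−r} in f_m. -/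
/-- `x` lies strictly inside the open cyclic arc from `a` to `b` (counterclockwise),
where the vertices of the convex `m`-gon are labeled by `ZMod m` in cyclic order. -/
def InOpenArc (m : ℕ) (a x b : ZMod m) : Prop :=
  0 < (x - a).val ∧ (x - a).val < (b - a).val

/-- `e` is a diagonal of the convex `m`-gon: an unordered pair `{i, j}` of vertices with
`j ∉ {i − 1, i, i + 1}`. -/
def IsDiagonal (m : ℕ) (e : Sym2 (ZMod m)) : Prop :=
  ∃ i j : ZMod m, e = s(i, j) ∧ j ≠ i - 1 ∧ j ≠ i ∧ j ≠ i + 1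

/-- Two chords `{a, b}` and `{c, d}` cross if their endpoints strictly interleave in
cyclic order: one of `c, d` lies in the open arc from `a` to `b` and the other in the
open arc from `b` to `a`. -/
def Crossing (m : ℕ) (e f : Sym2 (ZMod m)) : Prop :=
  ∃ a b c d : ZMod m, e = s(a, b) ∧ f = s(c, d) ∧
    ((InOpenArc m a c b ∧ InOpenArc m b d a) ∨ (InOpenArc m a d b ∧ InOpenArc m b c a))

/-- `N_m(r)`: the number of `r`-element sets of pairwise noncrossing diagonals of a
convex `m`-gon. -/
noncomputable def noncrossingDiagonalSets (m r : ℕ) : ℕ :=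
  Nat.card {S : Finset (Sym2 (ZMod m)) //
    S.card = r ∧ (∀ e ∈ S, IsDiagonal m e) ∧
    ∀ e ∈ S, ∀ f ∈ S, e ≠ f → ¬ Crossing m e f}

/-- The polynomial `f_m(t) = Σ_{r=0}^{m−3} N_m(r) t^r (1 − t)^{m−3−r}`. -/
noncomputable def fPoly (m : ℕ) : Polynomial ℤ :=
  ∑ r ∈ Finset.range (m - 2),
    (noncrossingDiagonalSets m r : ℤ) •
      (Polynomial.X ^ r * (1 - Polynomial.X) ^ (m - 3 - r))

namespace PolyDis
open Polynomial

/-- Crossing of chords given by their ordered endpoints. -/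
def cr (e f : ℕ × ℕ) : Prop :=
  (e.1 < f.1 ∧ f.1 < e.2 ∧ e.2 < f.2) ∨ (f.1 < e.1 ∧ e.1 < f.2 ∧ f.2 < e.2)

instance (e f : ℕ × ℕ) : Decidable (cr e f) := by unfold cr; infer_instance

/-- Pairwise noncrossing sets. -/
def NC (S : Finset (ℕ × ℕ)) : Prop := ∀ e ∈ S, ∀ f ∈ S, ¬ cr e f

instance (S : Finset (ℕ × ℕ)) : Decidable (NC S) := by unfold NC; infer_instance

/-- The counting polynomial of noncrossing subsets of `E`. -/
noncomputable def W (E : Finset (ℕ × ℕ)) : ℤ[X] :=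
  ∑ S ∈ E.powerset, if NC S then X ^ S.card else 0

lemma cr_symm {e f : ℕ × ℕ} (h : cr e f) : cr f e := by
  unfold cr at *; omega

lemma cr_irrefl (e : ℕ × ℕ) : ¬ cr e e := by
  unfold cr; omega

lemma NC_insert (e : ℕ × ℕ) (S : Finset (ℕ × ℕ)) :
    NC (insert e S) ↔ NC S ∧ ∀ f ∈ S, ¬ cr e f := by
  constructor
  · intro h
    refine ⟨fun a ha b hb => h a (Finset.mem_insert_of_mem ha) b (Finset.mem_insert_of_mem hb),
      fun f hf => h e (Finset.mem_insert_self _ _) f (Finset.mem_insert_of_mem hf)⟩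
  · rintro ⟨h1, h2⟩ a ha b hb
    rcases Finset.mem_insert.1 ha with ha' | ha'
    · rcases Finset.mem_insert.1 hb with hb' | hb'
      · rw [ha', hb']; exact cr_irrefl _
      · rw [ha']; exact h2 b hb'
    · rcases Finset.mem_insert.1 hb with hb' | hb'
      · rw [hb']; exact fun h => h2 a ha' (cr_symm h)
      · exact h1 a ha' b hb'

lemma W_empty : W ∅ = 1 := by
  simp [W, NC]

lemma W_insert (e : ℕ × ℕ) (E : Finset (ℕ × ℕ)) (he : e ∉ E) :
    W (insert e E) = W E + X * W (E.filter (fun f => ¬ cr e f)) := by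
  unfold W
  rw [Finset.sum_powerset_insert he]
  congr 1
  rw [Finset.mul_sum]
  symm
  refine (Finset.sum_congr rfl fun S hS => ?_).trans
    (Finset.sum_subset (s₁ := (E.filter (fun f => ¬ cr e f)).powerset) ?_ ?_)
  · rw [Finset.mem_powerset] at hS
    have h2 : ∀ f ∈ S, ¬ cr e f := fun f hf => (Finset.mem_filter.1 (hS hf)).2
    have h3 : e ∉ S := fun h => he (Finset.mem_filter.1 (hS h)).1
    rw [Finset.card_insert_of_notMem h3]
    by_cases h : NC S
    · rw [if_pos h, if_pos ((NC_insert e S).2 ⟨h, h2⟩)]; ring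
    · rw [if_neg h, if_neg (fun h' => h ((NC_insert e S).1 h').1)]; ring
  · exact Finset.powerset_mono.2 (Finset.filter_subset _ _)
  · intro S hS hS'
    rw [if_neg]
    intro h
    apply hS'
    rw [Finset.mem_powerset] at hS ⊢
    intro f hf
    exact Finset.mem_filter.2 ⟨hS hf, ((NC_insert e S).1 h).2 f hf⟩

lemma W_union (A : Finset (ℕ × ℕ)) : ∀ B : Finset (ℕ × ℕ), Disjoint A B →
    (∀ e ∈ A, ∀ f ∈ B, ¬ cr e f) → W (A ∪ B) = W A * W B := by
  induction A using Finset.strongInduction with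
  | H A ih =>
    intro B hd hc
    rcases A.eq_empty_or_nonempty with rfl | ⟨e, he⟩
    · simp [W_empty]
    · obtain ⟨A', heA', rfl⟩ : ∃ A', e ∉ A' ∧ insert e A' = A :=
        ⟨A.erase e, Finset.notMem_erase _ _, Finset.insert_erase he⟩
      rw [Finset.disjoint_insert_left] at hd
      have hss : A' ⊂ insert e A' := Finset.ssubset_insert heA'
      rw [Finset.insert_union, W_insert e (A' ∪ B) (by simp [heA', hd.1]), W_insert e A' heA',
        Finset.filter_union]
      have hB : B.filter (fun f => ¬ cr e f) = B :=
        Finset.filter_true_of_mem fun f hf => hc e he f hf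
      rw [hB, ih A' hss B hd.2 (fun a ha => hc a (Finset.mem_insert_of_mem ha)),
        ih (A'.filter (fun f => ¬ cr e f)) (lt_of_le_of_lt (Finset.filter_subset _ _) hss) B
          (Finset.disjoint_of_subset_left (Finset.filter_subset _ _) hd.2)
          (fun a ha => hc a (Finset.mem_insert_of_mem (Finset.filter_subset _ _ ha)))]
      ring

/-- All chords within `[l, r]`. -/
def EQ (l r : ℕ) : Finset (ℕ × ℕ) :=
  ((Finset.range (r + 1)) ×ˢ (Finset.range (r + 1))).filter (fun e => l ≤ e.1 ∧ e.1 + 2 ≤ e.2)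

/-- Chords within `[l, r]`, chords at `l` only up to `k`. -/
def ET (l k r : ℕ) : Finset (ℕ × ℕ) :=
  (EQ l r).filter (fun e => e.1 ≠ l ∨ e.2 ≤ k)

lemma mem_EQ {l r : ℕ} {e : ℕ × ℕ} : e ∈ EQ l r ↔ l ≤ e.1 ∧ e.1 + 2 ≤ e.2 ∧ e.2 ≤ r := by
  simp [EQ]; omega

lemma mem_ET {l k r : ℕ} {e : ℕ × ℕ} :
    e ∈ ET l k r ↔ (l ≤ e.1 ∧ e.1 + 2 ≤ e.2 ∧ e.2 ≤ r) ∧ (e.1 ≠ l ∨ e.2 ≤ k) := by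
  simp only [ET, Finset.mem_filter, mem_EQ]

/-- Chords excluding the root `(l, r)`. -/
abbrev EP (l r : ℕ) : Finset (ℕ × ℕ) := ET l (r - 1) r

lemma W_EQ_one (l : ℕ) : W (EQ l (l + 1)) = 1 := by
  have : EQ l (l + 1) = ∅ := by
    ext e; rw [mem_EQ]; simp; omega
  rw [this, W_empty]

lemma W_EQ (l r : ℕ) (h : l + 2 ≤ r) : W (EQ l r) = (1 + X) * W (EP l r) := by
  have h1 : EQ l r = insert (l, r) (EP l r) := by
    ext ⟨a, b⟩; simp only [mem_EQ, Finset.mem_insert, mem_ET, Prod.mk.injEq]; omega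
  have h2 : (EP l r).filter (fun f => ¬ cr (l, r) f) = EP l r := by
    apply Finset.filter_true_of_mem
    rintro ⟨a, b⟩ hf
    simp only [mem_ET] at hf
    unfold cr; simp only; omega
  rw [h1, W_insert, h2]
  · ring
  · simp only [mem_ET]; omega

lemma W_ET_step (l k r : ℕ) (h : l + 1 ≤ k) (hk : k + 1 < r) :
    W (ET l (k + 1) r) = W (ET l k r) + X * (W (EP l (k + 1)) * W (EQ (k + 1) r)) := by
  have h1 : ET l (k + 1) r = insert (l, k + 1) (ET l k r) := by
    ext ⟨a, b⟩; simp only [Finset.mem_insert, mem_ET, Prod.mk.injEq]; omega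
  have h2 : (ET l k r).filter (fun f => ¬ cr (l, k + 1) f) = EP l (k + 1) ∪ EQ (k + 1) r := by
    ext ⟨a, b⟩
    rw [Finset.mem_filter]
    simp only [Finset.mem_union, mem_ET, mem_EQ, cr]; omega
  rw [h1, W_insert, h2, W_union]
  · rw [Finset.disjoint_left]
    rintro ⟨a, b⟩
    simp only [mem_ET, mem_EQ]; omega
  · rintro ⟨a, b⟩ he ⟨c, d⟩ hf
    simp only [mem_ET, mem_EQ, cr] at *; omega
  · simp only [mem_ET]; omega

lemma W_ET_base (l r : ℕ) : W (ET l (l + 1) r) = W (EQ (l + 1) r) := by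
  congr 1
  ext ⟨a, b⟩; simp only [mem_ET, mem_EQ]; omega

lemma W_ET_sum (l r i : ℕ) (h : l + 1 + i < r) :
    W (ET l (l + 1 + i) r) = W (EQ (l + 1) r) +
      ∑ j ∈ Finset.range i, X * (W (EP l (l + 2 + j)) * W (EQ (l + 2 + j) r)) := by
  induction i with
  | zero => simp [W_ET_base]
  | succ i ih =>
    rw [← add_assoc, W_ET_step l (l + 1 + i) r (by omega) (by omega), ih (by omega),
      Finset.sum_range_succ, show l + 1 + i + 1 = l + 2 + i by ring, add_assoc]

/-- With `P l n` the polynomial of `[l, l+n+2]`. -/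
noncomputable def P (l n : ℕ) : ℤ[X] := W (EP l (l + n + 2))

lemma P_rec (l n : ℕ) : P l (n + 1) = (1 + X) * P (l + 1) n + X * P l n +
    X * (1 + X) * ∑ j ∈ Finset.range n, P l j * P (l + 2 + j) (n - 1 - j) := by
  unfold P EP
  rw [show l + (n + 1) + 2 - 1 = l + 1 + (n + 1) by omega, W_ET_sum _ _ _ (by omega),
    W_EQ _ _ (by omega), Finset.sum_range_succ, show l + (n + 1) + 2 = (l + 2 + n) + 1 by ring,
    W_EQ_one, Finset.mul_sum]
  rw [show l + 2 + n + 1 = l + 1 + n + 2 by ring, show l + 2 + n = l + n + 2 by ring]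
  have hs : ∀ a b c d c' : ℤ[X], c = c' → a + (c + X * (d * 1)) = a + X * d + c' := by
    rintro a b c d c' rfl; ring
  rw [show l + 1 + n + 2 - 1 = l + 1 + n + 1 by omega] at *
  apply hs _ 0
  · refine Finset.sum_congr rfl fun j hj => ?_
    rw [Finset.mem_range] at hj
    rw [W_EQ _ _ (by omega), show l + 2 + j + (n - 1 - j) + 2 = l + 1 + n + 2 by omega,
      show l + 2 + j = l + j + 2 by ring]
    ring

lemma P_zero (l : ℕ) : P l 0 = 1 := by
  have : EP l (l + 0 + 2) = ∅ := by
    ext ⟨a, b⟩; rw [mem_ET]; simp; omega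
  rw [P, this, W_empty]

lemma P_shift (n : ℕ) : ∀ l, P l n = P 0 n := by
  induction n using Nat.strong_induction_on with
  | _ n ih =>
    intro l
    cases n with
    | zero => simp [P_zero]
    | succ n =>
      rw [P_rec, P_rec, ih n (by omega) l, ih n (by omega) (l + 1), ih n (by omega) (0 + 1)]
      refine congrArg (fun z => (1 + X) * P 0 n + X * P 0 n + X * (1 + X) * z) ?_
      refine Finset.sum_congr rfl fun j hj => ?_
      rw [Finset.mem_range] at hj
      rw [ih j (by omega) l, ih (n - 1 - j) (by omega) (l + 2 + j),
        ih (n - 1 - j) (by omega) (0 + 2 + j)]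

lemma P_rec0 (n : ℕ) : P 0 (n + 1) = (1 + 2 * X) * P 0 n +
    X * (1 + X) * ∑ j ∈ Finset.range n, P 0 j * P 0 (n - 1 - j) := by
  rw [P_rec, P_shift n (0 + 1)]
  rw [Finset.sum_congr rfl fun j _ => by rw [P_shift (n - 1 - j) (0 + 2 + j)]]
  ring

lemma P_deg (n : ℕ) : (P 0 n).natDegree ≤ n := by
  induction n using Nat.strong_induction_on with
  | _ n ih =>
    cases n with
    | zero => simp [P_zero]
    | succ n =>
      rw [P_rec0]
      refine natDegree_add_le_of_degree_le ?_ ?_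
      · have h1 : (1 + 2 * X : ℤ[X]).natDegree ≤ 1 := by compute_degree
        have := natDegree_mul_le_of_le h1 (ih n (by omega))
        omega
      · rw [Finset.mul_sum]
        refine natDegree_sum_le_of_forall_le _ _ fun j hj => ?_
        rw [Finset.mem_range] at hj
        have h1 : (X * (1 + X) : ℤ[X]).natDegree ≤ 2 := by compute_degree
        have := natDegree_mul_le_of_le h1
          (natDegree_mul_le_of_le (ih j (by omega)) (ih (n - 1 - j) (by omega)))
        omega

lemma P_symm (n : ℕ) : (P 0 n).comp (-1 - X) = (-1) ^ n * P 0 n := by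
  induction n using Nat.strong_induction_on with
  | _ n ih =>
    cases n with
    | zero => simp [P_zero]
    | succ n =>
      rw [P_rec0]
      have hs : (∑ j ∈ Finset.range n, P 0 j * P 0 (n - 1 - j)).comp (-1 - X) =
          (-1) ^ (n + 1) * ∑ j ∈ Finset.range n, P 0 j * P 0 (n - 1 - j) := by
        rw [Polynomial.sum_comp, Finset.mul_sum]
        refine Finset.sum_congr rfl fun j hj => ?_
        rw [Finset.mem_range] at hj
        rw [mul_comp, ih j (by omega), ih (n - 1 - j) (by omega)]
        obtain ⟨k, rfl⟩ : ∃ k, n = j + k + 1 := ⟨n - 1 - j, by omega⟩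
        rw [show j + k + 1 - 1 - j = k by omega]
        ring
      rw [add_comp, mul_comp, mul_comp, hs, ih n (by omega)]
      simp only [add_comp, mul_comp, one_comp, X_comp, ofNat_comp]
      ring

lemma W_coeff (E : Finset (ℕ × ℕ)) (r : ℕ) :
    (W E).coeff r = ((E.powerset.filter (fun S => S.card = r ∧ NC S)).card : ℤ) := by
  unfold W
  rw [finsetSum_coeff, Finset.card_filter, Nat.cast_sum]
  refine Finset.sum_congr rfl fun S _ => ?_
  by_cases h : NC S
  · simp [h, coeff_X_pow, eq_comm]
  · simp [h]


section tail

lemma eval_f (d : ℕ) (p : ℤ[X]) (hp : p.natDegree ≤ d) (t : ℚ) (ht : t ≠ 1) :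
    eval₂ (Int.castRingHom ℚ) t (∑ r ∈ Finset.range (d + 1),
      (p.coeff r) • (X ^ r * (1 - X) ^ (d - r))) =
    (1 - t) ^ d * eval₂ (Int.castRingHom ℚ) (t / (1 - t)) p := by
  have h1 : (1 - t) ≠ 0 := sub_ne_zero.2 (Ne.symm ht)
  rw [eval₂_eq_sum_range' _ (Nat.lt_succ_of_le hp), eval₂_finsetSum, Finset.mul_sum]
  refine Finset.sum_congr rfl fun r hr => ?_
  rw [Finset.mem_range] at hr
  obtain ⟨k, rfl⟩ : ∃ k, d = r + k := ⟨d - r, by omega⟩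
  rw [show r + k - r = k by omega, smul_eq_C_mul]
  simp only [eval₂_mul, eval₂_pow, eval₂_X, eval₂_sub, eval₂_one, eval₂_C]
  rw [div_pow, pow_add]
  field_simp

lemma reflect_f (d : ℕ) (p : ℤ[X]) (hp : p.natDegree ≤ d)
    (hs : p.comp (-1 - X) = (-1) ^ d * p) (f : ℤ[X])
    (hf : f = ∑ r ∈ Finset.range (d + 1), (p.coeff r) • (X ^ r * (1 - X) ^ (d - r))) 
    (hfd : f.natDegree ≤ d) :
    reflect d f = f := by
  apply Polynomial.map_injective (Int.castRingHom ℚ) Int.cast_injective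
  refine Polynomial.eq_of_infinite_eval_eq _ _ ((Set.Ioi_infinite (1 : ℚ)).mono ?_)
  intro s hs1
  have hs1 : 1 < s := hs1
  have hs0 : s ≠ 0 := by positivity
  show eval _ _ = eval _ _
  rw [eval_map, eval_map]
  have : Invertible (s⁻¹) := invertibleOfNonzero (inv_ne_zero hs0)
  have h := eval₂_reflect_mul_pow (Int.castRingHom ℚ) s⁻¹ d f hfd
  rw [invOf_eq_inv, inv_inv] at h
  have hne : s⁻¹ ≠ 1 := by
    intro h; rw [inv_eq_one] at h; linarith
  have e1 := eval_f d p hp s (by linarith)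
  have e2 := eval_f d p hp s⁻¹ hne
  rw [← hf] at e1 e2
  have e3 := congrArg (eval₂ (Int.castRingHom ℚ) (s / (1 - s))) hs
  rw [eval₂_comp] at e3
  simp only [eval₂_mul, eval₂_pow, eval₂_X, eval₂_sub, eval₂_neg, eval₂_one] at e3
  have h1 : (1 - s) ≠ 0 := by linarith
  have h2 : (s - 1) ≠ 0 := by linarith
  have e4 : s⁻¹ / (1 - s⁻¹) = -1 - s / (1 - s) := by
    have : 1 - s⁻¹ ≠ 0 := sub_ne_zero.2 (Ne.symm hne)
    field_simp
    ring
  rw [e2, e4, e3] at h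
  rw [e1]
  have h3 : eval₂ (Int.castRingHom ℚ) s (reflect d f) =
      (s * (1 - s⁻¹) * (-1)) ^ d * eval₂ (Int.castRingHom ℚ) (s / (1 - s)) p := by
    rw [mul_pow, mul_pow, mul_assoc, mul_assoc, ← h, mul_comm, mul_assoc, ← mul_pow,
      inv_mul_cancel₀ hs0, one_pow, mul_one]
  rw [h3]
  congr 2
  field_simp
  ring

lemma f_deg (d : ℕ) (c : ℕ → ℤ) :
    (∑ r ∈ Finset.range (d + 1), (c r) • (X ^ r * (1 - X) ^ (d - r)) : ℤ[X]).natDegree ≤ d := by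
  refine natDegree_sum_le_of_forall_le _ _ fun r hr => ?_
  rw [Finset.mem_range] at hr
  refine (natDegree_smul_le _ _).trans ?_
  have h1 : (1 - X : ℤ[X]).natDegree ≤ 1 := by compute_degree
  have := natDegree_mul_le_of_le (natDegree_X_pow_le (R := ℤ) r)
    (natDegree_pow_le_of_le (d - r) h1)
  omega

lemma f_zero (d : ℕ) (c : ℕ → ℤ) :
    (∑ r ∈ Finset.range (d + 1), (c r) • (X ^ r * (1 - X) ^ (d - r)) : ℤ[X]).coeff 0 = c 0 := by
  rw [Finset.sum_range_succ', coeff_zero_eq_eval_zero]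
  simp [eval_finsetSum]

end tail

section bridge

lemma cast_inj' {m a b : ℕ} (ha : a < m) (hb : b < m) :
    ((a : ZMod m) = (b : ZMod m)) ↔ a = b := by
  rw [ZMod.natCast_eq_natCast_iff', Nat.mod_eq_of_lt ha, Nat.mod_eq_of_lt hb]

lemma val_sub' {m a x : ℕ} (ha : a < m) (hx : x < m) :
    ((x : ZMod m) - (a : ZMod m)).val = if a ≤ x then x - a else x + m - a := by
  split_ifs with h
  · rw [← Nat.cast_sub h, ZMod.val_natCast, Nat.mod_eq_of_lt (by omega)]
  · have : ((x : ZMod m) - (a : ZMod m)) = ((x + m - a : ℕ) : ZMod m) := by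
      rw [Nat.cast_sub (by omega)]; simp
    rw [this, ZMod.val_natCast, Nat.mod_eq_of_lt (by omega)]

lemma arc_iff {m a x b : ℕ} (ha : a < m) (hx : x < m) (hb : b < m) :
    InOpenArc m a x b ↔ (a < x ∧ x < b) ∨ (b < a ∧ a < x) ∨ (x < b ∧ b < a) := by
  unfold InOpenArc
  rw [val_sub' ha hx, val_sub' ha hb]
  split_ifs <;> omega

/-- The chord of the polygon given by ordered endpoints. -/
def phi (m : ℕ) (p : ℕ × ℕ) : Sym2 (ZMod m) := s((p.1 : ZMod m), (p.2 : ZMod m))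

lemma mem_EP {n : ℕ} {p : ℕ × ℕ} :
    p ∈ EP 0 (0 + n + 2) ↔ p.1 + 2 ≤ p.2 ∧ p.2 ≤ n + 2 ∧ (p.1 ≠ 0 ∨ p.2 ≤ n + 1) := by
  rw [mem_ET]; omega

lemma phi_inj {n : ℕ} {p q : ℕ × ℕ} (hp : p ∈ EP 0 (0 + n + 2)) (hq : q ∈ EP 0 (0 + n + 2))
    (h : phi (n + 3) p = phi (n + 3) q) : p = q := by
  rw [mem_EP] at hp hq
  unfold phi at h
  rw [Sym2.eq_iff, cast_inj' (by omega) (by omega), cast_inj' (by omega) (by omega),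
    cast_inj' (by omega) (by omega), cast_inj' (by omega) (by omega)] at h
  ext <;> omega

lemma diag_iff {n : ℕ} (e : Sym2 (ZMod (n + 3))) :
    IsDiagonal (n + 3) e ↔ ∃ p ∈ EP 0 (0 + n + 2), phi (n + 3) p = e := by
  constructor
  · rintro ⟨i, j, rfl, h1, h2, h3⟩
    obtain ⟨a, ha, rfl⟩ : ∃ a : ℕ, a < n + 3 ∧ (a : ZMod (n + 3)) = i :=
      ⟨i.val, ZMod.val_lt i, ZMod.natCast_zmod_val i⟩
    obtain ⟨b, hb, rfl⟩ : ∃ a : ℕ, a < n + 3 ∧ (a : ZMod (n + 3)) = j :=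
      ⟨j.val, ZMod.val_lt j, ZMod.natCast_zmod_val j⟩
    have hz : ((n : ZMod (n + 3)) + 2 + 1) = 0 := by
      have := ZMod.natCast_self (n + 3)
      push_cast at this
      rw [← this]; ring
    have k1 : a ≠ b + 1 := by rintro rfl; apply h1; push_cast; ring
    have k2 : b ≠ a := by rintro rfl; exact h2 rfl
    have k3 : b ≠ a + 1 := by rintro rfl; apply h3; push_cast; ring
    have k4 : ¬ (a = 0 ∧ b = n + 2) := by
      rintro ⟨rfl, rfl⟩; apply h1; push_cast; rw [eq_sub_iff_add_eq, hz]
    have k5 : ¬ (b = 0 ∧ a = n + 2) := by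
      rintro ⟨rfl, rfl⟩; apply h3; push_cast; rw [hz]
    rcases lt_or_gt_of_ne k2 with h | h
    · exact ⟨(b, a), mem_EP.2 (by simp only; omega), Sym2.eq_swap⟩
    · exact ⟨(a, b), mem_EP.2 (by simp only; omega), rfl⟩
  · rintro ⟨⟨a, b⟩, hp, rfl⟩
    rw [mem_EP] at hp
    simp only at hp
    refine ⟨a, b, rfl, ?_, ?_, ?_⟩
    · intro h
      rw [eq_sub_iff_add_eq, ← Nat.cast_succ, ZMod.natCast_eq_natCast_iff',
        Nat.mod_eq_of_lt (show a < n + 3 by omega)] at h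
      rcases Nat.lt_or_ge (b + 1) (n + 3) with h' | h'
      · rw [Nat.mod_eq_of_lt h'] at h; omega
      · rw [show b.succ = n + 3 by omega, Nat.mod_self] at h; omega
    · rw [Ne, cast_inj' (by omega) (by omega)]; omega
    · rw [← Nat.cast_succ, Ne, cast_inj' (by omega) (by omega)]; omega

lemma cross_iff {n : ℕ} {p q : ℕ × ℕ} (hp : p ∈ EP 0 (0 + n + 2)) (hq : q ∈ EP 0 (0 + n + 2)) :
    Crossing (n + 3) (phi (n + 3) p) (phi (n + 3) q) ↔ cr p q := by
  obtain ⟨p1, p2⟩ := p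
  obtain ⟨q1, q2⟩ := q
  rw [mem_EP] at hp hq
  simp only at hp hq
  have a1 : p1 < n + 3 := by omega
  have a2 : p2 < n + 3 := by omega
  have b1 : q1 < n + 3 := by omega
  have b2 : q2 < n + 3 := by omega
  unfold phi cr
  simp only
  constructor
  · rintro ⟨a, b, c, d, h1, h2, h⟩
    rw [Sym2.eq_iff] at h1 h2
    rcases h1 with ⟨rfl, rfl⟩ | ⟨rfl, rfl⟩ <;> rcases h2 with ⟨rfl, rfl⟩ | ⟨rfl, rfl⟩ <;>
    · simp only [arc_iff, a1, a2, b1, b2] at h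
      omega
  · intro h
    refine ⟨p1, p2, q1, q2, rfl, rfl, ?_⟩
    simp only [arc_iff, a1, a2, b1, b2]
    omega

lemma bridge (n r : ℕ) :
    (noncrossingDiagonalSets (n + 3) r : ℤ) = (P 0 n).coeff r := by
  classical
  rw [P, W_coeff]
  congr 1
  unfold noncrossingDiagonalSets
  set A := (EP 0 (0 + n + 2)).powerset.filter (fun S => S.card = r ∧ NC S) with hA
  have hmem : ∀ S, S ∈ A ↔ S ⊆ EP 0 (0 + n + 2) ∧ S.card = r ∧ NC S := by
    intro S; rw [hA, Finset.mem_filter, Finset.mem_powerset]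
  have hcard : ∀ S, S ⊆ EP 0 (0 + n + 2) → (S.image (phi (n + 3))).card = S.card := by
    intro S hS
    exact Finset.card_image_of_injOn fun p hp q hq h => phi_inj (hS hp) (hS hq) h
  rw [← Nat.card_eq_finsetCard A]
  symm
  refine Nat.card_eq_of_bijective (fun S : A => ⟨S.1.image (phi (n + 3)), ?_, ?_, ?_⟩) ⟨?_, ?_⟩
  · obtain ⟨h1, h2, h3⟩ := (hmem S.1).1 S.2
    rw [hcard _ h1, h2]
  · obtain ⟨h1, h2, h3⟩ := (hmem S.1).1 S.2
    intro e he
    obtain ⟨p, hp, rfl⟩ := Finset.mem_image.1 he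
    exact (diag_iff _).2 ⟨p, h1 hp, rfl⟩
  · obtain ⟨h1, h2, h3⟩ := (hmem S.1).1 S.2
    intro e he f hf _
    obtain ⟨p, hp, rfl⟩ := Finset.mem_image.1 he
    obtain ⟨q, hq, rfl⟩ := Finset.mem_image.1 hf
    rw [cross_iff (h1 hp) (h1 hq)]
    exact h3 p hp q hq
  · rintro ⟨S, hS⟩ ⟨T, hT⟩ h
    simp only [Subtype.mk.injEq] at h ⊢
    have hS' := ((hmem S).1 hS).1
    have hT' := ((hmem T).1 hT).1
    ext p
    constructor
    · intro hp
      have : phi (n + 3) p ∈ T.image (phi (n + 3)) := h ▸ Finset.mem_image_of_mem _ hp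
      obtain ⟨q, hq, hqp⟩ := Finset.mem_image.1 this
      rwa [← phi_inj (hT' hq) (hS' hp) hqp]
    · intro hp
      have : phi (n + 3) p ∈ S.image (phi (n + 3)) := h ▸ Finset.mem_image_of_mem _ hp
      obtain ⟨q, hq, hqp⟩ := Finset.mem_image.1 this
      rwa [← phi_inj (hS' hq) (hT' hp) hqp]
  · rintro ⟨T, h1, h2, h3⟩
    have hsub : (EP 0 (0 + n + 2)).filter (fun p => phi (n + 3) p ∈ T) ⊆ EP 0 (0 + n + 2) :=
      Finset.filter_subset _ _
    have him : ((EP 0 (0 + n + 2)).filter (fun p => phi (n + 3) p ∈ T)).image (phi (n + 3))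
        = T := by
      ext e
      rw [Finset.mem_image]
      constructor
      · rintro ⟨p, hp, rfl⟩
        exact (Finset.mem_filter.1 hp).2
      · intro he
        obtain ⟨p, hp, rfl⟩ := (diag_iff e).1 (h2 e he)
        exact ⟨p, Finset.mem_filter.2 ⟨hp, he⟩, rfl⟩
    refine ⟨⟨_, (hmem _).2 ⟨hsub, ?_, ?_⟩⟩, Subtype.ext him⟩
    · rw [← hcard _ hsub, him, h1]
    · intro p hp q hq hc
      have hp' := Finset.mem_filter.1 hp
      have hq' := Finset.mem_filter.1 hq
      refine h3 _ hp'.2 _ hq'.2 ?_ ((cross_iff hp'.1 hq'.1).2 hc)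
      intro heq
      rw [phi_inj hp'.1 hq'.1 heq] at hc
      exact cr_irrefl _ hc

end bridge

end PolyDis

/-- `f_m(t)` has degree `m − 3` and is palindromic. -/
theorem fPoly_degree_and_palindromic (m : ℕ) (hm : 3 ≤ m) :
    (fPoly m).natDegree = m - 3 ∧
    ∀ r ≤ m - 3, (fPoly m).coeff r = (fPoly m).coeff (m - 3 - r) := by
  obtain ⟨n, rfl⟩ : ∃ n, m = n + 3 := ⟨m - 3, by omega⟩
  have hf : fPoly (n + 3) = ∑ r ∈ Finset.range (n + 1), ((PolyDis.P 0 n).coeff r) •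
      (Polynomial.X ^ r * (1 - Polynomial.X) ^ (n - r)) := by
    unfold fPoly
    rw [show n + 3 - 2 = n + 1 by omega, show n + 3 - 3 = n by omega]
    exact Finset.sum_congr rfl fun r _ => by rw [PolyDis.bridge]
  have hd : (fPoly (n + 3)).natDegree ≤ n := by
    rw [hf]; exact PolyDis.f_deg n _
  have hr := PolyDis.reflect_f n _ (PolyDis.P_deg n) (PolyDis.P_symm n) _ hf hd
  have hc : ∀ r ≤ n, (fPoly (n + 3)).coeff r = (fPoly (n + 3)).coeff (n - r) := by
    intro r hrn
    conv_lhs => rw [← hr]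
    rw [Polynomial.coeff_reflect, Polynomial.revAt_le hrn]
  rw [show n + 3 - 3 = n by omega]
  refine ⟨le_antisymm hd (Polynomial.le_natDegree_of_ne_zero ?_), hc⟩
  have h0 : (fPoly (n + 3)).coeff 0 = (PolyDis.P 0 n).coeff 0 := by
    rw [hf, PolyDis.f_zero]
  rw [hc n le_rfl, Nat.sub_self, h0, PolyDis.P, PolyDis.W_coeff]
  rw [Nat.cast_ne_zero, Finset.card_ne_zero]
  exact ⟨∅, Finset.mem_filter.2 ⟨Finset.empty_mem_powerset _, rfl, by simp [PolyDis.NC]⟩⟩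
end

section
/- Let m ≥ 2 be an integer, and for r ≥ 0 let B_m(r) denote the number of multisets of r chords of a convex m-gon (unordered pairs of distinct vertices, with repetition of chords allowed) such that any two distinct chords occurring in the multiset are noncrossing and every vertex lies on an even number of chords counted with multiplicity. Then there exists a polynomial g ∈ ℤ[t] of degree at most 3m − 6 such that the formal power series identity (1 − t²)^{2m−3} · Σ_{r≥0} B_m(r)·t^r = g(t) holds, and g is palindromic with respect to degree 3m − 6: for every r, the coefficient of t^r in g equals the coefficient of t^{3m−6−r} in g. -/
open scoped Classical in
/-- `B_m(r)`: the number of multisets of `r` chords of a convex `m`-gon (self-loops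
forbidden, repetitions allowed) in which any two distinct chords are noncrossing and
every vertex lies on an even number of chords counted with multiplicity. -/
noncomputable def evenPlanarMultigraphCount (m r : ℕ) : ℕ :=
  Nat.card {M : Multiset (Sym2 (ZMod m)) //
    Multiset.card M = r ∧ (∀ e ∈ M, ¬ e.IsDiag) ∧
    (∀ e ∈ M, ∀ f ∈ M, e ≠ f → ¬ Crossing m e f) ∧
    ∀ v : ZMod m, Even (Multiset.countP (fun e => v ∈ e) M)}

namespace EPM
open Finset

/-- Crossing of chords given as ordered pairs of naturals. -/
def cr (e f : ℕ × ℕ) : Prop :=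
  (e.1 < f.1 ∧ f.1 < e.2 ∧ e.2 < f.2) ∨ (f.1 < e.1 ∧ e.1 < f.2 ∧ f.2 < e.2)

instance (e f : ℕ × ℕ) : Decidable (cr e f) := by unfold cr; infer_instance

/-- Noncrossing sets of chords. -/
def NC (F : Finset (ℕ × ℕ)) : Prop := ∀ e ∈ F, ∀ f ∈ F, ¬ cr e f

instance (F : Finset (ℕ × ℕ)) : Decidable (NC F) := by unfold NC; infer_instance

/-- Diagonals of the polygon with vertex set `W`. -/
def Dg (W : Finset ℕ) : Finset (ℕ × ℕ) :=
  (W ×ˢ W).filter (fun e => (∃ x ∈ W, e.1 < x ∧ x < e.2) ∧ (∃ y ∈ W, y < e.1 ∨ e.2 < y))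

/-- Noncrossing sets of diagonals. -/
def Fam (W : Finset ℕ) : Finset (Finset (ℕ × ℕ)) := (Dg W).powerset.filter NC

/-- Signed count of dissections containing `G`. -/
def A (W : Finset ℕ) (G : Finset (ℕ × ℕ)) : ℤ :=
  ∑ F ∈ (Fam W).filter (fun F => G ⊆ F), (-1 : ℤ) ^ F.card

lemma mem_Dg {W : Finset ℕ} {e : ℕ × ℕ} : e ∈ Dg W ↔ (e.1 ∈ W ∧ e.2 ∈ W) ∧
    (∃ x ∈ W, e.1 < x ∧ x < e.2) ∧ (∃ y ∈ W, y < e.1 ∨ e.2 < y) := by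
  simp [Dg, mem_filter, mem_product]

lemma mem_Fam {W : Finset ℕ} {F : Finset (ℕ × ℕ)} : F ∈ Fam W ↔ F ⊆ Dg W ∧ NC F := by
  simp [Fam]

/-- inner part -/
def W1 (W : Finset ℕ) (e : ℕ × ℕ) : Finset ℕ := W.filter (fun x => e.1 ≤ x ∧ x ≤ e.2)
/-- outer part -/
def W2 (W : Finset ℕ) (e : ℕ × ℕ) : Finset ℕ := W.filter (fun x => x ≤ e.1 ∨ e.2 ≤ x)

lemma cr_self (e : ℕ × ℕ) : ¬ cr e e := by unfold cr; omega
lemma cr_symm {e f : ℕ × ℕ} (h : cr e f) : cr f e := by unfold cr at *; omega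

lemma split_D1 {W : Finset ℕ} {e : ℕ × ℕ} (he : e ∈ Dg W) {f : ℕ × ℕ} (hf : f ∈ Dg (W1 W e)) :
    f ∈ Dg W ∧ ¬ cr e f ∧ f ≠ e ∧ (e.1 ≤ f.1 ∧ f.2 ≤ e.2 ∧ f.1 < f.2) := by
  obtain ⟨a, b⟩ := e
  obtain ⟨c, d⟩ := f
  simp only [mem_Dg, W1, mem_filter, cr, ne_eq, Prod.mk.injEq] at *
  obtain ⟨⟨h1, h2⟩, ⟨x, hx, hx'⟩, ⟨y, hy, hy'⟩⟩ := hf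
  refine ⟨⟨⟨h1.1, h2.1⟩, ⟨x, hx.1, hx'⟩, ⟨y, hy.1, hy'⟩⟩, ?_, ?_, ?_⟩ <;> omega

lemma split_D2 {W : Finset ℕ} {e : ℕ × ℕ} (he : e ∈ Dg W) {f : ℕ × ℕ} (hf : f ∈ Dg (W2 W e)) :
    f ∈ Dg W ∧ ¬ cr e f ∧ f ≠ e ∧ (f.1 < f.2 ∧ (f.1 ≤ e.1 ∨ e.2 ≤ f.1) ∧ (f.2 ≤ e.1 ∨ e.2 ≤ f.2)) := by
  obtain ⟨a, b⟩ := e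
  obtain ⟨c, d⟩ := f
  simp only [mem_Dg, W2, mem_filter, cr, ne_eq, Prod.mk.injEq] at *
  obtain ⟨⟨h1, h2⟩, ⟨x, hx, hx'⟩, ⟨y, hy, hy'⟩⟩ := hf
  refine ⟨⟨⟨h1.1, h2.1⟩, ⟨x, hx.1, hx'⟩, ⟨y, hy.1, hy'⟩⟩, ?_, ?_, ?_⟩ <;> omega

lemma split_D {W : Finset ℕ} {e : ℕ × ℕ} (he : e ∈ Dg W) {f : ℕ × ℕ} (hf : f ∈ Dg W)
    (h : ¬ cr e f) (hne : f ≠ e) : f ∈ Dg (W1 W e) ∨ f ∈ Dg (W2 W e) := by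
  obtain ⟨a, b⟩ := e
  obtain ⟨c, d⟩ := f
  simp only [mem_Dg, W1, W2, mem_filter, cr, ne_eq, Prod.mk.injEq] at *
  obtain ⟨⟨h1, h2⟩, ⟨x, hx, hx'⟩, ⟨y, hy, hy'⟩⟩ := hf
  obtain ⟨⟨k1, k2⟩, ⟨z, hz, hz'⟩, ⟨w, hw, hw'⟩⟩ := he
  by_cases hin : a ≤ c ∧ d ≤ b
  · left
    refine ⟨⟨⟨h1, by omega⟩, ⟨h2, by omega⟩⟩, ⟨x, ⟨hx, by omega⟩, hx'⟩, ?_⟩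
    by_cases hac : a < c
    · exact ⟨a, ⟨k1, by omega⟩, by omega⟩
    · exact ⟨b, ⟨k2, by omega⟩, by omega⟩
  · right
    refine ⟨⟨⟨h1, by omega⟩, ⟨h2, by omega⟩⟩, ?_, ?_⟩
    · by_cases hac : c < a ∧ a < d
      · exact ⟨a, ⟨k1, by omega⟩, by omega⟩
      by_cases hac' : c < b ∧ b < d
      · exact ⟨b, ⟨k2, by omega⟩, by omega⟩
      exact ⟨x, ⟨hx, by omega⟩, by omega⟩
    · by_cases hac : a < c
      · exact ⟨a, ⟨k1, by omega⟩, by omega⟩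
      by_cases hac' : d < b
      · exact ⟨b, ⟨k2, by omega⟩, by omega⟩
      exact ⟨y, ⟨hy, by omega⟩, by omega⟩

lemma split_disj {W : Finset ℕ} {e : ℕ × ℕ} (he : e ∈ Dg W) {f : ℕ × ℕ} (h1 : f ∈ Dg (W1 W e))
    (h2 : f ∈ Dg (W2 W e)) : False := by
  have := split_D1 he h1
  have h2 := split_D2 he h2
  obtain ⟨a, b⟩ := e
  obtain ⟨c, d⟩ := f
  simp only [ne_eq, Prod.mk.injEq] at *
  omega

lemma split_nc {W : Finset ℕ} {e : ℕ × ℕ} (he : e ∈ Dg W) {f g : ℕ × ℕ} (h1 : f ∈ Dg (W1 W e))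
    (h2 : g ∈ Dg (W2 W e)) : ¬ cr f g := by
  have := split_D1 he h1
  have h2 := split_D2 he h2
  simp only [cr] at *
  omega

lemma split_card {W : Finset ℕ} {e : ℕ × ℕ} (he : e ∈ Dg W) :
    (W1 W e).card + (W2 W e).card = W.card + 2 ∧ 3 ≤ (W1 W e).card ∧ 3 ≤ (W2 W e).card := by
  obtain ⟨a, b⟩ := e
  simp only [mem_Dg] at he
  obtain ⟨⟨k1, k2⟩, ⟨z, hz, hz'⟩, ⟨w, hw, hw'⟩⟩ := he
  refine ⟨?_, ?_, ?_⟩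
  · rw [← card_union_add_card_inter]
    congr 1
    · congr 1
      ext x
      simp only [W1, W2, mem_union, mem_filter]
      have : (a ≤ x ∧ x ≤ b) ∨ (x ≤ a ∨ b ≤ x) := by omega
      tauto
    · have : W1 W (a, b) ∩ W2 W (a, b) = {a, b} := by
        ext x
        simp only [W1, W2, mem_inter, mem_filter, mem_insert, mem_singleton]
        constructor
        · intro h; omega
        · rintro (rfl | rfl)
          · exact ⟨⟨k1, by omega⟩, k1, by omega⟩
          · exact ⟨⟨k2, by omega⟩, k2, by omega⟩
      rw [this, card_pair (by omega)]
  · have : ({a, z, b} : Finset ℕ) ⊆ W1 W (a, b) := by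
      intro x
      simp only [W1, mem_filter, mem_insert, mem_singleton]
      rintro (rfl | rfl | rfl) <;> refine ⟨by assumption, by omega⟩
    have h3 : ({a, z, b} : Finset ℕ).card = 3 := by
      rw [card_eq_three]; exact ⟨a, z, b, by omega, by omega, by omega, rfl⟩
    rw [← h3]; exact card_le_card this
  · have : ({a, w, b} : Finset ℕ) ⊆ W2 W (a, b) := by
      intro x
      simp only [W2, mem_filter, mem_insert, mem_singleton]
      rintro (rfl | rfl | rfl) <;> refine ⟨by assumption, by omega⟩
    have h3 : ({a, w, b} : Finset ℕ).card = 3 := by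
      rw [card_eq_three]; exact ⟨a, w, b, by omega, by omega, by omega, rfl⟩
    rw [← h3]; exact card_le_card this

lemma fam_sub {W : Finset ℕ} {F G : Finset (ℕ × ℕ)} (h : F ∈ Fam W) (hG : G ⊆ F) : G ∈ Fam W := by
  rw [mem_Fam] at *
  exact ⟨hG.trans h.1, fun e he f hf => h.2 e (hG he) f (hG hf)⟩

lemma fam_W1 {W : Finset ℕ} {e : ℕ × ℕ} {F : Finset (ℕ × ℕ)} (h : F ∈ Fam W) :
    F ∩ Dg (W1 W e) ∈ Fam (W1 W e) := by
  have := fam_sub h (inter_subset_left (s₂ := Dg (W1 W e)))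
  rw [mem_Fam] at *
  exact ⟨inter_subset_right, this.2⟩

lemma fam_W2 {W : Finset ℕ} {e : ℕ × ℕ} {F : Finset (ℕ × ℕ)} (h : F ∈ Fam W) :
    F ∩ Dg (W2 W e) ∈ Fam (W2 W e) := by
  have := fam_sub h (inter_subset_left (s₂ := Dg (W2 W e)))
  rw [mem_Fam] at *
  exact ⟨inter_subset_right, this.2⟩

lemma fam_join {W : Finset ℕ} {e : ℕ × ℕ} (he : e ∈ Dg W) {F1 F2 : Finset (ℕ × ℕ)}
    (h1 : F1 ∈ Fam (W1 W e)) (h2 : F2 ∈ Fam (W2 W e)) : insert e (F1 ∪ F2) ∈ Fam W := by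
  rw [mem_Fam] at *
  constructor
  · intro f hf
    rw [mem_insert, mem_union] at hf
    rcases hf with rfl | hf | hf
    · exact he
    · exact (split_D1 he (h1.1 hf)).1
    · exact (split_D2 he (h2.1 hf)).1
  · intro f hf g hg
    rw [mem_insert, mem_union] at hf hg
    rcases hf with rfl | hf | hf <;> rcases hg with rfl | hg | hg
    · exact cr_self _
    · exact (split_D1 he (h1.1 hg)).2.1
    · exact (split_D2 he (h2.1 hg)).2.1
    · exact fun h => (split_D1 he (h1.1 hf)).2.1 (cr_symm h)
    · exact h1.2 f hf g hg
    · exact split_nc he (h1.1 hf) (h2.1 hg)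
    · exact fun h => (split_D2 he (h2.1 hf)).2.1 (cr_symm h)
    · exact fun h => split_nc he (h1.1 hg) (h2.1 hf) (cr_symm h)
    · exact h2.2 f hf g hg

lemma fam_decomp {W : Finset ℕ} {e : ℕ × ℕ} {F : Finset (ℕ × ℕ)} (h : F ∈ Fam W) (heF : e ∈ F) :
    insert e (F ∩ Dg (W1 W e) ∪ F ∩ Dg (W2 W e)) = F := by
  rw [mem_Fam] at h
  ext f
  simp only [mem_insert, mem_union, mem_inter]
  constructor
  · rintro (rfl | h | h)
    · exact heF
    · exact h.1
    · exact h.1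
  · intro hf
    by_cases hfe : f = e
    · exact Or.inl hfe
    · have := split_D (h.1 heF) (h.1 hf) (h.2 e heF f hf) hfe
      tauto

lemma join_card {W : Finset ℕ} {e : ℕ × ℕ} (he : e ∈ Dg W) {F1 F2 : Finset (ℕ × ℕ)}
    (h1 : F1 ⊆ Dg (W1 W e)) (h2 : F2 ⊆ Dg (W2 W e)) :
    (insert e (F1 ∪ F2)).card = F1.card + F2.card + 1 := by
  rw [card_insert_of_notMem, card_union_of_disjoint]
  · rw [disjoint_left]
    exact fun f hf hf' => split_disj he (h1 hf) (h2 hf')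
  · rw [mem_union]
    rintro (h | h)
    · exact (split_D1 he (h1 h)).2.2.1 rfl
    · exact (split_D2 he (h2 h)).2.2.1 rfl

lemma card_bound : ∀ (n : ℕ) (W : Finset ℕ), W.card = n → 3 ≤ n → ∀ F ∈ Fam W, F.card + 3 ≤ n := by
  intro n
  induction n using Nat.strong_induction_on with
  | _ n ih =>
    intro W hW hn F hF
    rcases F.eq_empty_or_nonempty with rfl | ⟨e, he⟩
    · simpa using hn
    have heD := (mem_Fam.1 hF).1 he
    have hc := split_card heD
    rw [← fam_decomp hF he, join_card heD inter_subset_right inter_subset_right]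
    have i1 := ih _ (by omega) (W1 W e) rfl hc.2.1 _ (fam_W1 hF)
    have i2 := ih _ (by omega) (W2 W e) rfl hc.2.2 _ (fam_W2 hF)
    omega

lemma A_split {W : Finset ℕ} {e : ℕ × ℕ} {G : Finset (ℕ × ℕ)} (hG : G ∈ Fam W) (heG : e ∈ G) :
    A W G = - (A (W1 W e) (G ∩ Dg (W1 W e)) * A (W2 W e) (G ∩ Dg (W2 W e))) := by
  have heD := (mem_Fam.1 hG).1 heG
  unfold A
  rw [sum_mul_sum, ← sum_product', ← sum_neg_distrib]
  refine sum_bij' (fun F _ => (F ∩ Dg (W1 W e), F ∩ Dg (W2 W e)))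
    (fun p _ => insert e (p.1 ∪ p.2)) ?_ ?_ ?_ ?_ ?_
  · intro F hF
    rw [mem_filter] at hF
    simp only [mem_product, mem_filter]
    exact ⟨⟨fam_W1 hF.1, inter_subset_inter_right hF.2⟩, fam_W2 hF.1, inter_subset_inter_right hF.2⟩
  · rintro ⟨F1, F2⟩ h
    simp only [mem_product, mem_filter] at h ⊢
    refine ⟨fam_join heD h.1.1 h.2.1, ?_⟩
    rw [← fam_decomp hG heG]
    exact insert_subset_insert _ (union_subset_union h.1.2 h.2.2)
  · intro F hF
    rw [mem_filter] at hF
    exact fam_decomp hF.1 (hF.2 heG)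
  · rintro ⟨F1, F2⟩ h
    simp only [mem_product, mem_filter] at h ⊢
    have k1 := (mem_Fam.1 h.1.1).1
    have k2 := (mem_Fam.1 h.2.1).1
    rw [Prod.mk.injEq]
    constructor
    · ext f
      simp only [mem_inter, mem_insert, mem_union]
      constructor
      · rintro ⟨rfl | hf | hf, hf'⟩
        · exact absurd rfl (split_D1 heD hf').2.2.1
        · exact hf
        · exact (split_disj heD hf' (k2 hf)).elim
      · exact fun hf => ⟨Or.inr (Or.inl hf), k1 hf⟩
    · ext f
      simp only [mem_inter, mem_insert, mem_union]
      constructor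
      · rintro ⟨rfl | hf | hf, hf'⟩
        · exact absurd rfl (split_D2 heD hf').2.2.1
        · exact (split_disj heD (k1 hf) hf').elim
        · exact hf
      · exact fun hf => ⟨Or.inr (Or.inr hf), k2 hf⟩
  · intro F hF
    rw [mem_filter] at hF
    conv_lhs => rw [← fam_decomp hF.1 (hF.2 heG)]
    rw [join_card heD inter_subset_right inter_subset_right]
    ring

lemma exists_ends {W : Finset ℕ} (h : 4 ≤ W.card) : ∃ a s M z, a ∈ W ∧ s ∈ W ∧ M ∈ W ∧ z ∈ W ∧
    a < s ∧ s < z ∧ z < M ∧ ∀ x ∈ W, x = a ∨ (s ≤ x ∧ x ≤ M) := by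
  have hne : W.Nonempty := card_pos.1 (by omega)
  have ha := W.min'_mem hne
  have hM := W.max'_mem hne
  set a := W.min' hne with hadef
  set M := W.max' hne with hMdef
  have hc : (W.erase a).card = W.card - 1 := card_erase_of_mem ha
  have hne' : (W.erase a).Nonempty := card_pos.1 (by omega)
  have hs := (W.erase a).min'_mem hne'
  set s := (W.erase a).min' hne' with hsdef
  have : (((W.erase a).erase s).erase M).Nonempty := by
    apply card_pos.1
    have h1 := card_erase_of_mem hs
    have h2 := pred_card_le_card_erase (s := (W.erase a).erase s) (a := M)
    omega
  obtain ⟨z, hz⟩ := this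
  simp only [mem_erase] at hz hs
  have lo : ∀ x ∈ W, a ≤ x := fun x hx => W.min'_le x hx
  have hi : ∀ x ∈ W, x ≤ M := fun x hx => W.le_max' x hx
  have lo2 : ∀ x ∈ W, x ≠ a → s ≤ x := fun x hx hxa =>
    (W.erase a).min'_le x (mem_erase.2 ⟨hxa, hx⟩)
  refine ⟨a, s, M, z, ha, hs.2, hM, hz.2.2.2, ?_, ?_, ?_, ?_⟩
  · have := lo s hs.2; have := hs.1; omega
  · have := lo2 z hz.2.2.2 hz.2.2.1; have := hz.2.1; omega
  · have := hi z hz.2.2.2; have := hz.1; omega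
  · intro x hx
    by_cases hxa : x = a
    · exact Or.inl hxa
    · exact Or.inr ⟨lo2 x hx hxa, hi x hx⟩

lemma A_empty {W : Finset ℕ} (hW : 4 ≤ W.card) (c : ℤ)
    (hA : ∀ G ∈ Fam W, G.Nonempty → A W G = c) : A W ∅ = c := by
  obtain ⟨a, s, M, z, ha, hs, hM, hz, has, hsz, hzM, hall⟩ := exists_ends hW
  set S := (Dg W).filter (fun e => e.1 = a) with hS
  have hSne : S.Nonempty := by
    refine ⟨(a, z), ?_⟩
    rw [hS, mem_filter, mem_Dg]
    exact ⟨⟨⟨ha, hz⟩, ⟨s, hs, has, hsz⟩, ⟨M, hM, Or.inr hzM⟩⟩, rfl⟩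
  have he0 : (s, M) ∈ Dg W := by
    rw [mem_Dg]
    exact ⟨⟨hs, hM⟩, ⟨z, hz, hsz, hzM⟩, ⟨a, ha, Or.inl has⟩⟩
  have hSFam : S ∈ Fam W := by
    rw [mem_Fam]
    refine ⟨filter_subset _ _, ?_⟩
    intro e he f hf
    have h1 := (mem_filter.1 he).2
    have h2 := (mem_filter.1 hf).2
    unfold cr
    omega
  have key : ∑ T ∈ S.powerset, (-1 : ℤ) ^ T.card * A W T = 0 := by
    have e1 : ∑ T ∈ S.powerset, (-1 : ℤ) ^ T.card * A W T
        = ∑ F ∈ Fam W, ∑ T ∈ (S ∩ F).powerset, (-1 : ℤ) ^ T.card * (-1 : ℤ) ^ F.card := by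
      simp only [A, mul_sum]
      refine sum_comm' ?_
      intro T F
      simp only [mem_powerset, mem_filter, subset_inter_iff]
      tauto
    rw [e1]
    simp only [← sum_mul, sum_powerset_neg_one_pow_card, ite_mul, one_mul, zero_mul]
    rw [← sum_filter]
    refine sum_involution (fun F _ => if (s, M) ∈ F then F.erase (s, M) else insert (s, M) F) ?_ ?_ ?_ ?_
    · intro F hF
      by_cases h : (s, M) ∈ F
      · simp only [h, if_true]
        have := card_erase_add_one h
        rw [← this]; ring
      · simp only [h, if_false]
        rw [card_insert_of_notMem h]; ring
    · intro F hF _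
      by_cases h : (s, M) ∈ F
      · simp only [h, if_true]
        intro h'
        rw [← h'] at h
        simp at h
      · simp only [h, if_false]
        intro h'
        rw [← h'] at h
        simp at h
    · intro F hF
      rw [mem_filter] at hF
      by_cases h : (s, M) ∈ F
      · simp only [h, if_true]
        rw [mem_filter]
        refine ⟨fam_sub hF.1 (erase_subset _ _), ?_⟩
        exact subset_empty.1 (hF.2 ▸ inter_subset_inter_left (erase_subset _ _))
      · simp only [h, if_false]
        have hF' := mem_Fam.1 hF.1
        have nocr : ∀ f ∈ F, ¬ cr (s, M) f := by
          intro f hf hcr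
          have hfD := hF'.1 hf
          have hfS : f ∉ S := fun h' => by
            have : f ∈ S ∩ F := mem_inter.2 ⟨h', hf⟩
            rw [hF.2] at this
            simp at this
          rw [hS, mem_filter] at hfS
          rw [mem_Dg] at hfD
          have h1 := hall _ hfD.1.1
          have h2 := hall _ hfD.1.2
          have h3 : f.1 ≠ a := fun h => hfS ⟨hF'.1 hf, h⟩
          simp only [cr] at hcr
          omega
        rw [mem_filter, mem_Fam]
        refine ⟨⟨insert_subset he0 hF'.1, ?_⟩, ?_⟩
        · intro e he f hf
          rw [mem_insert] at he hf
          rcases he with rfl | he <;> rcases hf with rfl | hf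
          · exact cr_self _
          · exact nocr f hf
          · exact fun h => nocr e he (cr_symm h)
          · exact hF'.2 e he f hf
        · rw [inter_insert_of_notMem, hF.2]
          rw [hS, mem_filter]
          simp only
          omega
    · intro F hF
      by_cases h : (s, M) ∈ F
      · simp [h, insert_erase]
      · simp [h]
  have hall0 := sum_powerset_neg_one_pow_card (x := S)
  rw [if_neg hSne.ne_empty] at hall0
  have hmem : ∅ ∈ S.powerset := empty_mem_powerset S
  rw [← add_sum_erase _ _ hmem] at key hall0
  have : ∑ x ∈ S.powerset.erase ∅, (-1 : ℤ) ^ x.card * A W x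
      = (∑ x ∈ S.powerset.erase ∅, (-1 : ℤ) ^ x.card) * c := by
    rw [sum_mul]
    refine sum_congr rfl ?_
    intro T hT
    rw [mem_erase, mem_powerset] at hT
    rw [hA T (fam_sub hSFam hT.2) (nonempty_iff_ne_empty.2 hT.1)]
  rw [this] at key
  simp only [card_empty, pow_zero, one_mul] at key hall0
  have h2 : ∑ x ∈ S.powerset.erase ∅, (-1 : ℤ) ^ x.card = -1 := by linarith
  rw [h2] at key
  linarith

lemma A_eq : ∀ (n : ℕ) (W : Finset ℕ), W.card = n → 3 ≤ n → ∀ G ∈ Fam W,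
    A W G = (-1) ^ (n + 1) := by
  intro n
  induction n using Nat.strong_induction_on with
  | _ n ih =>
    intro W hW hn
    have hne : ∀ G ∈ Fam W, G.Nonempty → A W G = (-1) ^ (n + 1) := by
      rintro G hG ⟨e, he⟩
      have heD := (mem_Fam.1 hG).1 he
      have hc := split_card heD
      rw [A_split hG he, ih _ (by omega) (W1 W e) rfl hc.2.1 _ (fam_W1 hG),
        ih _ (by omega) (W2 W e) rfl hc.2.2 _ (fam_W2 hG), ← pow_add]
      have : (W1 W e).card + 1 + ((W2 W e).card + 1) = n + 1 + 3 := by omega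
      rw [this]; ring
    intro G hG
    rcases G.eq_empty_or_nonempty with rfl | hG'
    · by_cases h4 : 4 ≤ n
      · exact A_empty (by omega) _ hne
      · have hn3 : n = 3 := by omega
        have : (Fam W).filter (fun F => ∅ ⊆ F) = {∅} := by
          ext F
          rw [mem_filter, mem_singleton]
          constructor
          · intro h
            have := card_bound n W hW hn F h.1
            exact card_eq_zero.1 (by omega)
          · rintro rfl
            exact ⟨hG, Subset.refl _⟩
        rw [A, this, hn3]
        simp
    · exact hne G hG hG'

lemma f_symm (W : Finset ℕ) (hW : 3 ≤ W.card) (u : ℕ × ℕ → ℚ) :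
    ∑ F ∈ Fam W, ∏ e ∈ F, (-1 - u e) = (-1) ^ (W.card + 1) * ∑ F ∈ Fam W, ∏ e ∈ F, u e := by
  have e1 : ∀ F : Finset (ℕ × ℕ), ∏ e ∈ F, (-1 - u e) =
      ∑ G ∈ F.powerset, (-1) ^ F.card * ∏ e ∈ G, u e := by
    intro F
    rw [← mul_sum, ← prod_one_add, ← prod_const, ← prod_mul_distrib]
    refine prod_congr rfl fun e _ => by ring
  simp only [e1]
  have e2 : ∑ F ∈ Fam W, ∑ G ∈ F.powerset, (-1) ^ F.card * ∏ e ∈ G, u e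
      = ∑ G ∈ Fam W, ∑ F ∈ (Fam W).filter (fun F => G ⊆ F), (-1) ^ F.card * ∏ e ∈ G, u e := by
    refine sum_comm' ?_
    intro F G
    simp only [mem_powerset, mem_filter]
    constructor
    · exact fun h => ⟨⟨h.1, h.2⟩, fam_sub h.1 h.2⟩
    · exact fun h => ⟨h.1.1, h.1.2⟩
  rw [e2, mul_sum]
  refine sum_congr rfl ?_
  intro G hG
  rw [← sum_mul]
  congr 1
  have := A_eq _ W rfl hW G hG
  rw [A] at this
  exact_mod_cast this

end EPM
namespace EPM
open Finset

/-- All chords. -/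
def Ch (m : ℕ) : Finset (ℕ × ℕ) := ((range m) ×ˢ (range m)).filter (fun e => e.1 < e.2)
/-- Noncrossing chord sets. -/
def NCF (m : ℕ) : Finset (Finset (ℕ × ℕ)) := (Ch m).powerset.filter NC
/-- Sides. -/
def sd (m : ℕ) : Finset (ℕ × ℕ) := insert (0, m - 1) ((range (m - 1)).image (fun i => (i, i + 1)))

lemma mem_Ch {m : ℕ} {e : ℕ × ℕ} : e ∈ Ch m ↔ e.1 < e.2 ∧ e.2 < m := by
  simp only [Ch, mem_filter, mem_product, mem_range]; omega

lemma mem_NCF {m : ℕ} {F : Finset (ℕ × ℕ)} : F ∈ NCF m ↔ F ⊆ Ch m ∧ NC F := by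
  simp [NCF]

lemma mem_sd {m : ℕ} {e : ℕ × ℕ} (hm : 3 ≤ m) : e ∈ sd m ↔
    e ∈ Ch m ∧ (e.2 = e.1 + 1 ∨ (e.1 = 0 ∧ e.2 = m - 1)) := by
  obtain ⟨a, b⟩ := e
  simp only [sd, mem_insert, mem_image, mem_range, Prod.mk.injEq, mem_Ch]
  constructor
  · rintro (h | ⟨i, h⟩) <;> omega
  · rintro ⟨h, h' | h'⟩
    · exact Or.inr ⟨a, by omega⟩
    · exact Or.inl h'

lemma mem_Dg_range {m : ℕ} {e : ℕ × ℕ} (hm : 3 ≤ m) : e ∈ Dg (range m) ↔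
    e ∈ Ch m ∧ ¬ (e.2 = e.1 + 1 ∨ (e.1 = 0 ∧ e.2 = m - 1)) := by
  obtain ⟨a, b⟩ := e
  simp only [mem_Dg, mem_range, mem_Ch]
  constructor
  · rintro ⟨h, ⟨x, hx⟩, ⟨y, hy⟩⟩
    omega
  · intro h
    refine ⟨by omega, ⟨a + 1, by omega⟩, ?_⟩
    by_cases ha : a = 0
    · exact ⟨m - 1, by omega⟩
    · exact ⟨0, by omega⟩

lemma sd_nocr {m : ℕ} (hm : 3 ≤ m) {e f : ℕ × ℕ} (he : e ∈ sd m) (hf : f ∈ Ch m) : ¬ cr e f := by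
  rw [mem_sd hm, mem_Ch] at he
  rw [mem_Ch] at hf
  unfold cr; omega

lemma sum_NCF {m : ℕ} (hm : 3 ≤ m) (u : ℕ × ℕ → ℚ) :
    ∑ F ∈ NCF m, ∏ e ∈ F, u e =
      (∏ e ∈ sd m, (1 + u e)) * ∑ F ∈ Fam (range m), ∏ e ∈ F, u e := by
  rw [prod_one_add, sum_mul_sum, ← sum_product']
  have dj : ∀ e, e ∈ sd m → e ∈ Dg (range m) → False := by
    intro e h1 h2
    rw [mem_sd hm] at h1
    rw [mem_Dg_range hm] at h2
    exact h2.2 h1.2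
  have un : ∀ e ∈ Ch m, e ∈ sd m ∨ e ∈ Dg (range m) := by
    intro e he
    rw [mem_sd hm, mem_Dg_range hm]
    tauto
  refine sum_bij' (fun F _ => (F ∩ sd m, F ∩ Dg (range m))) (fun p _ => p.1 ∪ p.2) ?_ ?_ ?_ ?_ ?_
  · intro F hF
    rw [mem_NCF] at hF
    simp only [mem_product, mem_powerset, mem_Fam]
    exact ⟨inter_subset_right, inter_subset_right,
      fun e he f hf => hF.2 e (mem_inter.1 he).1 f (mem_inter.1 hf).1⟩
  · rintro ⟨T, F⟩ h
    simp only [mem_product, mem_powerset, mem_Fam, mem_NCF] at h ⊢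
    have c1 : ∀ e ∈ T, e ∈ Ch m := fun e he => ((mem_sd hm).1 (h.1 he)).1
    have c2 : ∀ e ∈ F, e ∈ Ch m := fun e he => ((mem_Dg_range hm).1 (h.2.1 he)).1
    refine ⟨union_subset c1 c2, ?_⟩
    intro e he f hf
    rw [mem_union] at he hf
    rcases he with he | he
    · exact sd_nocr hm (h.1 he) (hf.elim (c1 f) (c2 f))
    · rcases hf with hf | hf
      · exact fun h' => sd_nocr hm (h.1 hf) (c2 e he) (cr_symm h')
      · exact h.2.2 e he f hf
  · intro F hF
    rw [mem_NCF] at hF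
    ext e
    have := un e
    have := @hF.1 e
    simp only [mem_union, mem_inter]
    tauto
  · rintro ⟨T, F⟩ h
    simp only [mem_product, mem_powerset, mem_Fam] at h
    rw [Prod.mk.injEq]
    constructor <;>
    · ext e
      have := dj e
      have := @h.1 e
      have := @h.2.1 e
      simp only [mem_union, mem_inter]
      tauto
  · intro F hF
    rw [mem_NCF] at hF
    rw [← prod_union]
    · congr 1
      ext e
      have := un e
      have := @hF.1 e
      simp only [mem_union, mem_inter]
      tauto
    · rw [disjoint_left]
      exact fun e h1 h2 => dj e (mem_inter.1 h1).2 (mem_inter.1 h2).2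

lemma prod_sd {m : ℕ} (hm : 3 ≤ m) (h : ℕ × ℕ → ℚ) :
    ∏ e ∈ sd m, h e = h (0, m - 1) * ∏ i ∈ range (m - 1), h (i, i + 1) := by
  rw [sd, prod_insert, prod_image]
  · intro a _ b _ hab
    simpa using hab
  · simp only [mem_image, mem_range, Prod.mk.injEq, not_exists]
    intro x; omega

lemma card_sd {m : ℕ} (hm : 3 ≤ m) : (sd m).card = m := by
  rw [sd, card_insert_of_notMem, card_image_of_injective, card_range]
  · omega
  · intro a b hab
    simpa using hab
  · simp only [mem_image, mem_range, Prod.mk.injEq, not_exists]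
    intro x; omega

lemma NCF_card {m : ℕ} (hm : 2 ≤ m) {F : Finset (ℕ × ℕ)} (hF : F ∈ NCF m) : F.card ≤ 2 * m - 3 := by
  by_cases h3 : 3 ≤ m
  · rw [mem_NCF] at hF
    have h1 : F ⊆ (sd m) ∪ (F ∩ Dg (range m)) := by
      intro e he
      rw [mem_union, mem_inter, mem_sd h3, mem_Dg_range h3]
      have := hF.1 he
      tauto
    have h2 := card_le_card h1
    have h4 := card_union_le (sd m) (F ∩ Dg (range m))
    rw [card_sd h3] at h4
    have h5 := card_bound m (range m) (card_range m) h3 (F ∩ Dg (range m)) (by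
      rw [mem_Fam]
      exact ⟨inter_subset_right,
        fun e he f hf => hF.2 e (mem_inter.1 he).1 f (mem_inter.1 hf).1⟩)
    omega
  · obtain rfl : m = 2 := by omega
    rw [mem_NCF] at hF
    have := card_le_card hF.1
    have h2 : (Ch 2).card = 1 := by decide
    omega

/-- sign of a vertex -/
def sg (S : Finset ℕ) (v : ℕ) : ℚ := if v ∈ S then -1 else 1
/-- sign of a chord -/
def sgc (S : Finset ℕ) (e : ℕ × ℕ) : ℚ := sg S e.1 * sg S e.2

lemma sg_sq (S : Finset ℕ) (v : ℕ) : sg S v * sg S v = 1 := by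
  unfold sg; split_ifs <;> norm_num

lemma sgc_sq (S : Finset ℕ) (e : ℕ × ℕ) : sgc S e * sgc S e = 1 := by
  unfold sgc
  linear_combination (sg S e.2 * sg S e.2) * sg_sq S e.1 + sg_sq S e.2

lemma prod_sgc_path (S : Finset ℕ) (k : ℕ) :
    ∏ i ∈ range k, sgc S (i, i + 1) = sg S 0 * sg S k := by
  induction k with
  | zero => simp [sg_sq]
  | succ k ih =>
    rw [prod_range_succ, ih, sgc]
    linear_combination (sg S 0 * sg S (k + 1)) * sg_sq S k

lemma prod_sgc_sd {m : ℕ} (hm : 3 ≤ m) (S : Finset ℕ) : ∏ e ∈ sd m, sgc S e = 1 := by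
  rw [prod_sd hm, prod_sgc_path]
  have := sgc_sq S (0, m - 1)
  simpa [sgc] using this

/-- `x/(1-x)` weights -/
def uu (S : Finset ℕ) (x : ℚ) (e : ℕ × ℕ) : ℚ := sgc S e * x / (1 - sgc S e * x)

lemma one_sub_ne {S : Finset ℕ} {x : ℚ} (hx : 1 - x ^ 2 ≠ 0) (e : ℕ × ℕ) : 1 - sgc S e * x ≠ 0 := by
  intro h
  apply hx
  linear_combination (1 + sgc S e * x) * h + x ^ 2 * sgc_sq S e

lemma inv_ne {x : ℚ} (h0 : x ≠ 0) (hx : 1 - x ^ 2 ≠ 0) : 1 - x⁻¹ ^ 2 ≠ 0 := by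
  intro h
  apply hx
  field_simp at h
  linarith

lemma uu_inv {S : Finset ℕ} {x : ℚ} (h0 : x ≠ 0) (hx : 1 - x ^ 2 ≠ 0) (e : ℕ × ℕ) :
    uu S x⁻¹ e = -1 - uu S x e := by
  have h1 := one_sub_ne (S := S) hx e
  have h2 := one_sub_ne (S := S) (inv_ne h0 hx) e
  have h3 := sgc_sq S e
  unfold uu
  rw [div_eq_iff h2]
  have : -1 - sgc S e * x / (1 - sgc S e * x) = -1 / (1 - sgc S e * x) := by
    field_simp; ring
  rw [this, div_mul_eq_mul_div, eq_div_iff h1]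
  have h4 : x⁻¹ * x = 1 := inv_mul_cancel₀ h0
  linear_combination (-(sgc S e * sgc S e)) * h4 - h3

lemma H_symm {m : ℕ} (hm : 3 ≤ m) (S : Finset ℕ) {x : ℚ} (h0 : x ≠ 0) (hx : 1 - x ^ 2 ≠ 0) :
    ∑ F ∈ NCF m, ∏ e ∈ F, uu S x⁻¹ e = - x ^ m * ∑ F ∈ NCF m, ∏ e ∈ F, uu S x e := by
  rw [sum_NCF hm, sum_NCF hm]
  simp only [uu_inv h0 hx]
  rw [f_symm _ (by simpa using hm), card_range]
  have : ∏ e ∈ sd m, (1 + (-1 - uu S x e)) = (-1) ^ m * x ^ m * ∏ e ∈ sd m, (1 + uu S x e) := by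
    have h1 : ∀ e ∈ sd m, (1 + (-1 - uu S x e)) = ((-1) * x) * (sgc S e * (1 + uu S x e)) := by
      intro e _
      have := one_sub_ne (S := S) hx e
      unfold uu
      field_simp
      ring
    rw [prod_congr rfl h1, prod_mul_distrib, prod_mul_distrib (f := fun e => sgc S e),
      prod_sgc_sd hm, prod_const, card_sd hm, mul_pow]
    ring
  rw [this]
  have h2 : (-1 : ℚ) ^ m * (-1) ^ m = 1 := by rw [← mul_pow]; norm_num
  rw [pow_succ]
  linear_combination (-(x ^ m * (∏ e ∈ sd m, (1 + uu S x e)) *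
    ∑ F ∈ Fam (range m), ∏ e ∈ F, uu S x e)) * h2

open Polynomial in
/-- The polynomial `2 ^ m * g`. -/
noncomputable def K (m : ℕ) : ℚ[X] :=
  ∑ S ∈ (range m).powerset, ∑ F ∈ NCF m, (1 - X ^ 2) ^ (2 * m - 3 - F.card) *
    ∏ e ∈ F, (C (sgc S e) * X * (1 + C (sgc S e) * X))

lemma eval_K {m : ℕ} (hm : 2 ≤ m) {x : ℚ} (hx : 1 - x ^ 2 ≠ 0) :
    (K m).eval x = (1 - x ^ 2) ^ (2 * m - 3) *
      ∑ S ∈ (range m).powerset, ∑ F ∈ NCF m, ∏ e ∈ F, uu S x e := by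
  simp only [K, Polynomial.eval_finsetSum, mul_sum, Polynomial.eval_mul, Polynomial.eval_pow,
    Polynomial.eval_sub, Polynomial.eval_add, Polynomial.eval_one, Polynomial.eval_X,
    Polynomial.eval_C, Polynomial.eval_prod]
  refine sum_congr rfl fun S _ => sum_congr rfl fun F hF => ?_
  have hc := NCF_card hm hF
  have : (1 - x ^ 2) ^ (2 * m - 3) = (1 - x ^ 2) ^ (2 * m - 3 - F.card) * (1 - x ^ 2) ^ F.card := by
    rw [← pow_add]; congr 1; omega
  rw [this, mul_assoc]
  congr 1
  rw [← prod_const, ← prod_mul_distrib]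
  refine prod_congr rfl fun e _ => ?_
  have := one_sub_ne (S := S) hx e
  unfold uu
  rw [mul_div_assoc', eq_div_iff this]
  linear_combination (-(sgc S e * x ^ 3)) * sgc_sq S e

lemma natDegree_K {m : ℕ} (hm : 2 ≤ m) : (K m).natDegree ≤ 4 * m - 6 := by
  unfold K
  refine Polynomial.natDegree_sum_le_of_forall_le _ _ fun S _ => ?_
  refine Polynomial.natDegree_sum_le_of_forall_le _ _ fun F hF => ?_
  have hc := NCF_card hm hF
  have h1 : ((1 - Polynomial.X ^ 2 : Polynomial ℚ) ^ (2 * m - 3 - F.card)).natDegree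
      ≤ (2 * m - 3 - F.card) * 2 := by
    refine Polynomial.natDegree_pow_le_of_le _ ?_
    compute_degree
  have h2 : (∏ e ∈ F, (Polynomial.C (sgc S e) * Polynomial.X *
      (1 + Polynomial.C (sgc S e) * Polynomial.X))).natDegree ≤ F.card * 2 := by
    refine (Polynomial.natDegree_prod_le _ _).trans ?_
    refine (Finset.sum_le_card_nsmul _ _ 2 fun e _ => ?_).trans (by simp)
    compute_degree
  refine Polynomial.natDegree_mul_le.trans ?_
  omega

lemma K_refl {m : ℕ} (hm : 3 ≤ m) :
    (K m).reflect (4 * m - 6) = Polynomial.X ^ m * K m := by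
  refine Polynomial.eq_of_infinite_eval_eq _ _ ?_
  have hfin : ({0, 1, -1} : Set ℚ).Finite := by simp
  refine hfin.infinite_compl.mono ?_
  intro x hx
  simp only [Set.mem_compl_iff, Set.mem_insert_iff, Set.mem_singleton_iff, not_or] at hx
  have h0 := hx.1
  have hx2 : 1 - x ^ 2 ≠ 0 := by
    intro h
    have : (x - 1) * (x + 1) = 0 := by linear_combination -h
    rcases mul_eq_zero.1 this with h | h
    · exact hx.2.1 (by linarith)
    · exact hx.2.2 (by linarith)
  let _ : Invertible x⁻¹ := invertibleOfNonzero (inv_ne_zero h0)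
  have hr := Polynomial.eval₂_reflect_mul_pow (RingHom.id ℚ) (x⁻¹) (4 * m - 6) (K m)
    (natDegree_K (by omega))
  rw [invOf_eq_inv, inv_inv, ← Polynomial.eval, ← Polynomial.eval,
    eval_K (by omega) (inv_ne h0 hx2)] at hr
  simp only [H_symm hm _ h0 hx2] at hr
  rw [← mul_sum] at hr
  simp only [Set.mem_ofPred_eq, Polynomial.eval_mul, Polynomial.eval_pow, Polynomial.eval_X]
  rw [eval_K (by omega) hx2]
  have hN : 4 * m - 6 = 2 * (2 * m - 3) := by omega
  have hodd : Odd (2 * m - 3) := ⟨m - 2, by omega⟩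
  have h5 : (1 - x⁻¹ ^ 2) ^ (2 * m - 3) * x ^ (4 * m - 6) = - (1 - x ^ 2) ^ (2 * m - 3) := by
    rw [hN, pow_mul, ← mul_pow, ← hodd.neg_pow]
    congr 1
    field_simp
    ring
  have h6 : x⁻¹ ^ (4 * m - 6) * x ^ (4 * m - 6) = 1 := by
    rw [← mul_pow, inv_mul_cancel₀ h0, one_pow]
  rw [← hN] at *
  set Q := ∑ S ∈ (range m).powerset, ∑ F ∈ NCF m, ∏ e ∈ F, uu S x e
  linear_combination (x ^ (4 * m - 6)) * hr - Polynomial.eval x (Polynomial.reflect (4 * m - 6) (K m)) * h6 - (x ^ m * Q) * h5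

lemma K_two : K 2 = 4 := by
  have h1 : (range 2).powerset = {∅, {0}, {1}, {0, 1}} := by decide
  have h2 : NCF 2 = {∅, {(0, 1)}} := by decide
  unfold K
  have h3 : ∀ f : Finset ℕ → Polynomial ℚ, ∑ S ∈ (range 2).powerset, f S =
      f ∅ + (f {0} + (f {1} + f {0, 1})) := by
    intro f
    rw [h1, sum_insert (by decide), sum_insert (by decide), sum_insert (by decide), sum_singleton]
  rw [h3, h2]
  simp [sum_insert, sgc, sg]
  ring

lemma K_coeff {m : ℕ} (hm : 2 ≤ m) : (∀ k, 3 * m - 6 < k → (K m).coeff k = 0) ∧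
    ∀ r ≤ 3 * m - 6, (K m).coeff r = (K m).coeff (3 * m - 6 - r) := by
  by_cases h3 : 3 ≤ m
  · have hd := natDegree_K hm
    have key : ∀ k ≤ 4 * m - 6, (K m).coeff k =
        if m ≤ 4 * m - 6 - k then (K m).coeff (4 * m - 6 - k - m) else 0 := by
      intro k hk
      rw [← Polynomial.coeff_X_pow_mul', ← K_refl h3, Polynomial.coeff_reflect,
        Polynomial.revAt_le (by omega)]
      congr 1; omega
    constructor
    · intro k hk
      by_cases h : k ≤ 4 * m - 6
      · rw [key k h, if_neg (by omega)]
      · exact Polynomial.coeff_eq_zero_of_natDegree_lt (by omega)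
    · intro r hr
      rw [key r (by omega), if_pos (by omega)]
      congr 1; omega
  · obtain rfl : m = 2 := by omega
    rw [K_two]
    constructor
    · intro k hk
      exact Polynomial.coeff_eq_zero_of_natDegree_lt (by
        have : (4 : Polynomial ℚ).natDegree = 0 := Polynomial.natDegree_ofNat 4
        omega)
    · intro r hr
      congr 1; omega
end EPM
namespace EPM
open Finset

lemma sum_signs (m : ℕ) (d : ℕ → ℕ) :
    ∑ S ∈ (range m).powerset, ∏ v ∈ range m, sg S v ^ d v =
      if ∀ v ∈ range m, Even (d v) then (2 : ℚ) ^ m else 0 := by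
  have h1 : ∀ S ∈ (range m).powerset, ∏ v ∈ range m, sg S v ^ d v =
      (∏ v ∈ S, (-1 : ℚ) ^ d v) * ∏ v ∈ range m \ S, 1 := by
    intro S hS
    rw [mem_powerset] at hS
    rw [← prod_sdiff hS, mul_comm]
    congr 1
    · exact prod_congr rfl fun v hv => by rw [sg, if_pos hv]
    · exact prod_congr rfl fun v hv => by rw [sg, if_neg (mem_sdiff.1 hv).2, one_pow]
  rw [sum_congr rfl h1, ← prod_add]
  split_ifs with h
  · rw [prod_congr rfl (g := fun _ => (2 : ℚ)), prod_const, card_range]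
    intro v hv
    rw [(h v hv).neg_one_pow]; norm_num
  · push Not at h
    obtain ⟨v, hv, hv'⟩ := h
    refine prod_eq_zero hv ?_
    rw [(Nat.not_even_iff_odd.1 hv').neg_one_pow]; norm_num

/-- degree of a vertex -/
def dg (F : Finset (ℕ × ℕ)) (l : ℕ × ℕ → ℕ) (v : ℕ) : ℕ :=
  ∑ e ∈ F, if v = e.1 ∨ v = e.2 then l e else 0

lemma prod_sgc {m : ℕ} {F : Finset (ℕ × ℕ)} (hF : F ⊆ Ch m) (S : Finset ℕ) (l : ℕ × ℕ → ℕ) :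
    ∏ e ∈ F, sgc S e ^ l e = ∏ v ∈ range m, sg S v ^ dg F l v := by
  simp only [dg, ← prod_pow_eq_pow_sum]
  rw [prod_comm]
  refine prod_congr rfl fun e he => ?_
  have hc := mem_Ch.1 (hF he)
  have h1 : ∀ v ∈ range m, sg S v ^ (if v = e.1 ∨ v = e.2 then l e else 0) =
      (if v = e.1 then sg S v ^ l e else 1) * (if v = e.2 then sg S v ^ l e else 1) := by
    intro v _
    by_cases h1 : v = e.1
    · have h2 : ¬ v = e.2 := by omega
      simp [h1]; intro h; omega
    · by_cases h2 : v = e.2 <;> simp [h1, h2]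
      intro h; omega
  rw [prod_congr rfl h1, prod_mul_distrib, prod_ite_eq', prod_ite_eq',
    if_pos (mem_range.2 (by omega)), if_pos (mem_range.2 (by omega)), sgc, mul_pow]

/-- the series `σt/(1-σt)` -/
noncomputable def U (σ : ℚ) : PowerSeries ℚ := PowerSeries.mk (fun k => if k = 0 then 0 else σ ^ k)

lemma U_mul (σ : ℚ) (h : σ * σ = 1) : (1 - PowerSeries.X ^ 2) * U σ =
    PowerSeries.C σ * PowerSeries.X * (1 + PowerSeries.C σ * PowerSeries.X) := by
  have h1 : (1 - PowerSeries.C σ * PowerSeries.X) * U σ = PowerSeries.C σ * PowerSeries.X := by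
    ext n
    rw [sub_mul, one_mul, mul_assoc, map_sub, PowerSeries.coeff_C_mul, PowerSeries.coeff_C_mul]
    rcases n with _ | n
    · simp [U]
    · rw [PowerSeries.coeff_succ_X_mul, PowerSeries.coeff_X]
      rcases n with _ | n
      · simp [U]
      · simp [U, pow_succ]; ring
  have h2 : (PowerSeries.C σ * PowerSeries.C σ : PowerSeries ℚ) = 1 := by
    rw [← map_mul, h, map_one]
  linear_combination (1 + PowerSeries.C σ * PowerSeries.X) * h1 + (PowerSeries.X ^ 2 * U σ) * h2

/-- multiplicity functions of even planar multigraphs -/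
def Lset (m r : ℕ) : Finset ((ℕ × ℕ) →₀ ℕ) :=
  (NCF m).biUnion fun F => (finsuppAntidiag F r).filter
    (fun l : (ℕ × ℕ) →₀ ℕ => l.support = F ∧ ∀ v ∈ range m, Even (dg F l v))

lemma card_Lset (m r : ℕ) : (Lset m r).card = ∑ F ∈ NCF m, ((finsuppAntidiag F r).filter
    (fun l : (ℕ × ℕ) →₀ ℕ => l.support = F ∧ ∀ v ∈ range m, Even (dg F l v))).card := by
  refine card_biUnion ?_
  intro F _ G _ hne
  simp only [Function.onFun]
  rw [disjoint_left]
  intro l h1 h2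
  exact hne ((mem_filter.1 h1).2.1.symm.trans (mem_filter.1 h2).2.1)

lemma coeff_U (F : Finset (ℕ × ℕ)) (S : Finset ℕ) (r : ℕ) :
    PowerSeries.coeff r (∏ e ∈ F, U (sgc S e)) =
      ∑ l ∈ (finsuppAntidiag F r).filter (fun l => l.support = F), ∏ e ∈ F, sgc S e ^ l e := by
  rw [PowerSeries.coeff_prod, sum_filter]
  refine sum_congr rfl fun l hl => ?_
  rw [mem_finsuppAntidiag] at hl
  split_ifs with h
  · refine prod_congr rfl fun e he => ?_
    rw [← h, Finsupp.mem_support_iff] at he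
    simp [U, he]
  · have : ∃ e ∈ F, e ∉ l.support := by
      by_contra hcon
      push Not at hcon
      exact h (subset_antisymm hl.2 hcon)
    obtain ⟨e, he, he'⟩ := this
    refine prod_eq_zero he ?_
    rw [Finsupp.notMem_support_iff] at he'
    simp [U, he']

lemma sum_coeff (m r : ℕ) : ∑ S ∈ (range m).powerset, ∑ F ∈ NCF m,
    PowerSeries.coeff r (∏ e ∈ F, U (sgc S e)) = 2 ^ m * ((Lset m r).card : ℚ) := by
  rw [sum_comm, card_Lset]
  push_cast
  rw [mul_sum]
  refine sum_congr rfl fun F hF => ?_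
  simp only [coeff_U]
  rw [sum_comm]
  have hF' := (mem_NCF.1 hF).1
  simp only [prod_sgc hF', sum_signs]
  rw [← sum_filter, filter_filter, sum_const, nsmul_eq_mul, mul_comm]

lemma K_series {m : ℕ} (hm : 2 ≤ m) : (K m : PowerSeries ℚ) =
    PowerSeries.C (2 ^ m) * ((1 - PowerSeries.X ^ 2) ^ (2 * m - 3) *
      PowerSeries.mk (fun r => ((Lset m r).card : ℚ))) := by
  have h1 : PowerSeries.C (2 ^ m) * PowerSeries.mk (fun r => ((Lset m r).card : ℚ)) =
      ∑ S ∈ (range m).powerset, ∑ F ∈ NCF m, ∏ e ∈ F, U (sgc S e) := by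
    ext r
    rw [PowerSeries.coeff_C_mul, PowerSeries.coeff_mk, ← sum_coeff]
    simp only [map_sum]
  rw [mul_left_comm, h1, mul_sum, K, ← Polynomial.coeToPowerSeries.ringHom_apply, map_sum]
  refine sum_congr rfl fun S _ => ?_
  rw [mul_sum, map_sum]
  refine sum_congr rfl fun F hF => ?_
  have hc := NCF_card hm hF
  have : (1 - PowerSeries.X ^ 2 : PowerSeries ℚ) ^ (2 * m - 3) =
      (1 - PowerSeries.X ^ 2) ^ (2 * m - 3 - F.card) * (1 - PowerSeries.X ^ 2) ^ F.card := by
    rw [← pow_add]; congr 1; omega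
  rw [this, mul_assoc, ← prod_const, ← prod_mul_distrib]
  simp only [map_mul, map_pow, map_sub, map_one, map_prod, map_add,
    Polynomial.coeToPowerSeries.ringHom_apply, Polynomial.coe_X, Polynomial.coe_C]
  congr 1
  exact prod_congr rfl fun e _ => (U_mul _ (sgc_sq S e)).symm

lemma final {m : ℕ} (hm : 2 ≤ m) (B : ℕ → ℕ) (hB : ∀ r, B r = (Lset m r).card) :
    ∃ g : Polynomial ℤ, g.natDegree ≤ 3 * m - 6 ∧
      (1 - PowerSeries.X ^ 2) ^ (2 * m - 3) *
          PowerSeries.mk (fun r => (B r : ℤ)) = (g : PowerSeries ℤ) ∧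
      ∀ r ≤ 3 * m - 6, g.coeff r = g.coeff (3 * m - 6 - r) := by
  set P : PowerSeries ℤ := (1 - PowerSeries.X ^ 2) ^ (2 * m - 3) *
          PowerSeries.mk (fun r => (B r : ℤ)) with hP
  have hmap : PowerSeries.map (Int.castRingHom ℚ) P = (1 - PowerSeries.X ^ 2) ^ (2 * m - 3) *
      PowerSeries.mk (fun r => ((Lset m r).card : ℚ)) := by
    rw [hP]
    simp only [map_mul, map_pow, map_sub, map_one, PowerSeries.map_X]
    congr 1
    ext r
    simp [hB]
  have hco : ∀ k, (K m).coeff k = 2 ^ m * ((PowerSeries.coeff k P : ℤ) : ℚ) := by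
    intro k
    rw [← Polynomial.coeff_coe, K_series hm, ← hmap, PowerSeries.coeff_C_mul, PowerSeries.coeff_map]
    rfl
  have h2 : (2 : ℚ) ^ m ≠ 0 := by positivity
  obtain ⟨k1, k2⟩ := K_coeff hm
  have z : ∀ k, 3 * m - 6 < k → PowerSeries.coeff k P = 0 := by
    intro k hk
    have := k1 k hk
    rw [hco] at this
    exact_mod_cast (mul_eq_zero.1 this).resolve_left h2
  have hg : ∀ k, (PowerSeries.trunc (3 * m - 6 + 1) P).coeff k = PowerSeries.coeff k P := by
    intro k
    rw [PowerSeries.coeff_trunc]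
    split_ifs with h
    · rfl
    · rw [z k (by omega)]
  refine ⟨PowerSeries.trunc (3 * m - 6 + 1) P, ?_, ?_, ?_⟩
  · have := PowerSeries.natDegree_trunc_lt P (3 * m - 6)
    omega
  · ext k
    rw [Polynomial.coeff_coe, hg]
  · intro r hr
    rw [hg, hg]
    have := k2 r hr
    rw [hco, hco] at this
    exact_mod_cast mul_left_cancel₀ h2 this
end EPM
namespace EPM
open Finset

/-- chord to ordered pair -/
def psi (m : ℕ) (e : Sym2 (ZMod m)) : ℕ × ℕ := ((e.map ZMod.val).inf, (e.map ZMod.val).sup)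

lemma psi_mk (m : ℕ) (a b : ZMod m) : psi m s(a, b) = (min a.val b.val, max a.val b.val) := rfl

lemma val_sub_cases {m : ℕ} [NeZero m] (x a : ZMod m) :
    (a.val ≤ x.val ∧ (x - a).val = x.val - a.val) ∨
    (x.val < a.val ∧ (x - a).val = m + x.val - a.val) := by
  rcases le_or_gt a.val x.val with h | h
  · exact Or.inl ⟨h, ZMod.val_sub h⟩
  · right
    refine ⟨h, ?_⟩
    have h1 := ZMod.val_sub h.le
    have hlt := ZMod.val_lt a
    rw [← neg_sub a x, ZMod.neg_val, if_neg, h1]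
    · omega
    · intro h0
      rw [h0, ZMod.val_zero] at h1
      omega

lemma arc_iff {m : ℕ} [NeZero m] (a x b : ZMod m) : InOpenArc m a x b ↔
    (a.val < x.val ∧ x.val < b.val) ∨ (b.val < a.val ∧ a.val < x.val) ∨
    (x.val < b.val ∧ b.val < a.val) := by
  unfold InOpenArc
  have := ZMod.val_lt a
  have := ZMod.val_lt b
  have := ZMod.val_lt x
  rcases val_sub_cases x a with h | h <;> rcases val_sub_cases b a with h' | h' <;> omega

lemma crossing_iff {m : ℕ} [NeZero m] (e f : Sym2 (ZMod m)) :
    Crossing m e f ↔ cr (psi m e) (psi m f) := by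
  constructor
  · rintro ⟨a, b, c, d, rfl, rfl, h⟩
    simp only [arc_iff] at h
    simp only [psi_mk, cr]
    omega
  · induction e using Sym2.ind with
    | _ a b =>
    induction f using Sym2.ind with
    | _ c d =>
    intro h
    refine ⟨a, b, c, d, rfl, rfl, ?_⟩
    simp only [arc_iff]
    simp only [psi_mk, cr] at h
    omega

lemma psi_Ch {m : ℕ} [NeZero m] (e : Sym2 (ZMod m)) : psi m e ∈ Ch m ↔ ¬ e.IsDiag := by
  induction e using Sym2.ind with
  | _ a b =>
  rw [psi_mk, mem_Ch, Sym2.mk_isDiag_iff, ← (ZMod.val_injective m).eq_iff]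
  have := ZMod.val_lt a
  have := ZMod.val_lt b
  simp only
  omega

lemma psi_mem {m : ℕ} [NeZero m] (v : ZMod m) (e : Sym2 (ZMod m)) :
    (v.val = (psi m e).1 ∨ v.val = (psi m e).2) ↔ v ∈ e := by
  induction e using Sym2.ind with
  | _ a b =>
  rw [psi_mk, Sym2.mem_iff, ← (ZMod.val_injective m).eq_iff, ← (ZMod.val_injective m).eq_iff]
  simp only
  omega

lemma psi_inj {m : ℕ} [NeZero m] : Function.Injective (psi m) := by
  intro e f
  induction e using Sym2.ind with
  | _ a b =>
  induction f using Sym2.ind with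
  | _ c d =>
  rw [psi_mk, psi_mk, Prod.mk.injEq, Sym2.eq_iff]
  simp only [← (ZMod.val_injective m).eq_iff]
  omega

lemma psi_surj {m : ℕ} {p : ℕ × ℕ} (hp : p ∈ Ch m) :
    psi m s((p.1 : ZMod m), (p.2 : ZMod m)) = p := by
  rw [mem_Ch] at hp
  rw [psi_mk, ZMod.val_natCast_of_lt (by omega), ZMod.val_natCast_of_lt (by omega)]
  ext <;> simp only <;> omega

lemma dg_count (N : Multiset (ℕ × ℕ)) (v : ℕ) :
    dg N.toFinset (Multiset.toFinsupp N) v = N.countP (fun e => v = e.1 ∨ v = e.2) := by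
  rw [Multiset.countP_eq_card_filter, ← Multiset.toFinset_sum_count_eq, Multiset.toFinset_filter,
    sum_filter, dg]
  refine sum_congr rfl fun e _ => ?_
  split_ifs with h
  · rw [Multiset.toFinsupp_apply, Multiset.count_filter_of_pos (p := fun e : ℕ × ℕ => v = e.1 ∨ v = e.2) h]
  · rfl

lemma mem_Lset {m r : ℕ} (N : Multiset (ℕ × ℕ)) : Multiset.toFinsupp N ∈ Lset m r ↔
    N.toFinset ∈ NCF m ∧ N.card = r ∧ ∀ v < m, Even (N.countP (fun e => v = e.1 ∨ v = e.2)) := by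
  simp only [Lset, mem_biUnion, mem_filter, mem_finsuppAntidiag, Multiset.toFinsupp_support,
    mem_range, ← dg_count]
  constructor
  · rintro ⟨F, hF, ⟨h1, _⟩, rfl, h3⟩
    refine ⟨hF, ?_, h3⟩
    rw [← h1, ← Multiset.toFinset_sum_count_eq]
    rfl
  · rintro ⟨hF, h1, h3⟩
    refine ⟨_, hF, ⟨?_, Subset.refl _⟩, rfl, h3⟩
    rw [← h1, ← Multiset.toFinset_sum_count_eq]
    rfl

open scoped Classical in
lemma cond_iff {m r : ℕ} [NeZero m] (M : Multiset (Sym2 (ZMod m))) :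
    Multiset.toFinsupp (M.map (psi m)) ∈ Lset m r ↔
    (Multiset.card M = r ∧ (∀ e ∈ M, ¬ e.IsDiag) ∧
    (∀ e ∈ M, ∀ f ∈ M, e ≠ f → ¬ Crossing m e f) ∧
    ∀ v : ZMod m, Even (Multiset.countP (fun e => v ∈ e) M)) := by
  rw [mem_Lset, mem_NCF, Multiset.card_map]
  have h1 : (M.map (psi m)).toFinset ⊆ Ch m ↔ ∀ e ∈ M, ¬ e.IsDiag := by
    simp only [← psi_Ch, subset_iff, Multiset.mem_toFinset, Multiset.mem_map]
    constructor
    · exact fun h e he => h ⟨e, he, rfl⟩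
    · rintro h _ ⟨e, he, rfl⟩
      exact h e he
  have h2 : NC (M.map (psi m)).toFinset ↔ ∀ e ∈ M, ∀ f ∈ M, e ≠ f → ¬ Crossing m e f := by
    simp only [crossing_iff, NC, Multiset.mem_toFinset, Multiset.mem_map]
    constructor
    · exact fun h e he f hf _ => h _ ⟨e, he, rfl⟩ _ ⟨f, hf, rfl⟩
    · rintro h _ ⟨e, he, rfl⟩ _ ⟨f, hf, rfl⟩
      by_cases hef : e = f
      · rw [hef]; exact cr_self _
      · exact h e he f hf hef
  have h3 : ∀ v : ZMod m, (M.map (psi m)).countP (fun e => v.val = e.1 ∨ v.val = e.2) =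
      Multiset.countP (fun e => v ∈ e) M := by
    intro v
    rw [Multiset.countP_map, Multiset.countP_eq_card_filter]
    congr 1
    exact Multiset.filter_congr fun e _ => psi_mem v e
  have h4 : (∀ v < m, Even ((M.map (psi m)).countP (fun e => v = e.1 ∨ v = e.2))) ↔
      ∀ v : ZMod m, Even (Multiset.countP (fun e => v ∈ e) M) := by
    constructor
    · intro h v
      rw [← h3]
      exact h _ (ZMod.val_lt v)
    · intro h v hv
      have := h (v : ZMod m)
      rw [← h3, ZMod.val_natCast_of_lt hv] at this
      exact this
  rw [h1, h2, h4]
  tauto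

lemma count_eq {m : ℕ} [NeZero m] (r : ℕ) : evenPlanarMultigraphCount m r = (Lset m r).card := by
  rw [← Fintype.card_coe, ← Nat.card_eq_fintype_card, evenPlanarMultigraphCount]
  refine Nat.card_eq_of_bijective (fun M => ⟨Multiset.toFinsupp (M.1.map (psi m)),
    (cond_iff M.1).2 M.2⟩) ⟨?_, ?_⟩
  · intro M M' h
    have h1 := Subtype.ext_iff.1 h
    exact Subtype.ext (Multiset.map_injective psi_inj (Multiset.toFinsupp.injective h1))
  · rintro ⟨l, hl⟩
    obtain ⟨N, rfl⟩ := Multiset.toFinsupp.surjective l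
    have hN := (mem_NCF.1 ((mem_Lset N).1 hl).1).1
    have hmap : (N.map (fun p : ℕ × ℕ => s((p.1 : ZMod m), (p.2 : ZMod m)))).map (psi m) = N := by
      rw [Multiset.map_map]
      conv_rhs => rw [← Multiset.map_id N]
      refine Multiset.map_congr rfl fun p hp => ?_
      exact psi_surj (hN (Multiset.mem_toFinset.2 hp))
    refine ⟨⟨N.map (fun p : ℕ × ℕ => s((p.1 : ZMod m), (p.2 : ZMod m))), ?_⟩, ?_⟩
    · rw [← cond_iff, hmap]; exact hl
    · exact Subtype.ext (by simp only [hmap])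
end EPM

/-- There is a palindromic polynomial `g` of degree at most `3m − 6` with
`(1 − t²)^{2m−3} Σ_{r≥0} B_m(r) t^r = g(t)`. -/
theorem evenPlanarMultigraph_generating_series_symmetry (m : ℕ) (hm : 2 ≤ m) :
    ∃ g : Polynomial ℤ, g.natDegree ≤ 3 * m - 6 ∧
      (1 - PowerSeries.X ^ 2) ^ (2 * m - 3) *
          PowerSeries.mk (fun r => (evenPlanarMultigraphCount m r : ℤ)) =
        (g : PowerSeries ℤ) ∧
      ∀ r ≤ 3 * m - 6, g.coeff r = g.coeff (3 * m - 6 - r) := by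
  have : NeZero m := ⟨by omega⟩
  exact EPM.final hm (evenPlanarMultigraphCount m) EPM.count_eq
end
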